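/- Let A and B be unital C*-algebras, X an involutive Hilbert A-A-bimodule, Y an involutive Hilbert B-B-bimodule, and A ⊂ C_X, B ⊂ C_Y the unital inclusions of unital C*-algebras induced by X and Y. Then: (1) if there is an A-B-equivalence bimodule M such that M̃ ⊗_A X ⊗_A M ≅ Y as involutive Hilbert B-B-bimodules, then A ⊂ C_X and B ⊂ C_Y are strongly Morita equivalent; (2) if X and Y are full with both inner products, A' ∩ C_X = C1, and A ⊂ C_X and B ⊂ C_Y are strongly Morita equivalent, then there is an A-B-equivalence bimodule M such that M̃ ⊗_A X ⊗_A M ≅ Y as involutive Hilbert B-B-bimodules. -/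

import Mathlib

noncomputable section

open scoped BigOperators

/-- The data and axioms of a Hilbert `C`-`D`-bimodule in the sense of
Brown–Mingo–Shen: a bimodule over the C*-algebras `C` and `D` carrying a
left `C`-valued and a right `D`-valued inner product, compatible with the
module actions and satisfying the associativity relation
`⟨x, y⟩_C • z = x • ⟨y, z⟩_D`. -/
structure HilbertBimod (C : Type*) (D : Type*) (Y : Type*)
    [NormedRing C] [StarRing C] [NormedRing D] [StarRing D]
    [NormedAddCommGroup Y] where
  lsmul : C → Y → Y
  rsmul : Y → D → Y
  linner : Y → Y → C
  rinner : Y → Y → D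
  lsmul_add : ∀ c x y, lsmul c (x + y) = lsmul c x + lsmul c y
  add_lsmul : ∀ c c' x, lsmul (c + c') x = lsmul c x + lsmul c' x
  mul_lsmul : ∀ c c' x, lsmul (c * c') x = lsmul c (lsmul c' x)
  one_lsmul : ∀ x, lsmul 1 x = x
  rsmul_add : ∀ x y d, rsmul (x + y) d = rsmul x d + rsmul y d
  add_rsmul : ∀ x d d', rsmul x (d + d') = rsmul x d + rsmul x d'
  rsmul_mul : ∀ x d d', rsmul x (d * d') = rsmul (rsmul x d) d'
  rsmul_one : ∀ x, rsmul x 1 = x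
  lsmul_rsmul : ∀ c x d, rsmul (lsmul c x) d = lsmul c (rsmul x d)
  linner_add_left : ∀ x y z, linner (x + y) z = linner x z + linner y z
  linner_add_right : ∀ x y z, linner x (y + z) = linner x y + linner x z
  linner_lsmul_left : ∀ c x y, linner (lsmul c x) y = c * linner x y
  linner_star : ∀ x y, star (linner x y) = linner y x
  rinner_add_left : ∀ x y z, rinner (x + y) z = rinner x z + rinner y z
  rinner_add_right : ∀ x y z, rinner x (y + z) = rinner x y + rinner x z
  rinner_rsmul_right : ∀ x y d, rinner x (rsmul y d) = rinner x y * d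
  rinner_star : ∀ x y, star (rinner x y) = rinner y x
  inner_assoc : ∀ x y z, lsmul (linner x y) z = rsmul x (rinner y z)
  norm_linner_self : ∀ x, ‖linner x x‖ = ‖x‖ ^ 2
  norm_rinner_self : ∀ x, ‖rinner x x‖ = ‖x‖ ^ 2

/-- Fullness of the left inner product: the closed linear span of the left
inner products is all of `C`. -/
def HilbertBimod.LFull {C D Y : Type*} [NormedRing C] [StarRing C] [NormedAlgebra ℂ C]
    [NormedRing D] [StarRing D] [NormedAddCommGroup Y]
    (E : HilbertBimod C D Y) : Prop :=
  (Submodule.span ℂ {c : C | ∃ x y : Y, c = E.linner x y}).topologicalClosure = ⊤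

/-- Fullness of the right inner product. -/
def HilbertBimod.RFull {C D Y : Type*} [NormedRing C] [StarRing C]
    [NormedRing D] [StarRing D] [NormedAlgebra ℂ D] [NormedAddCommGroup Y]
    (E : HilbertBimod C D Y) : Prop :=
  (Submodule.span ℂ {d : D | ∃ x y : Y, d = E.rinner x y}).topologicalClosure = ⊤

/-- A C*-algebraic bundle over a group `G`, presented through the grading it
induces on the C*-algebra `C = ⊕_{t ∈ G} A_t` of its sections:  a family of
closed subspaces `A_t ⊆ C` with `A_t A_s ⊆ A_{ts}`, `A_t* = A_{t⁻¹}`, whose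
internal direct sum is all of `C`. -/
structure CStarBundle (G : Type*) [Group G] [DecidableEq G] (C : Type*)
    [NormedRing C] [StarRing C] [NormedAlgebra ℂ C] where
  fiber : G → Submodule ℂ C
  fiber_closed : ∀ t, IsClosed (fiber t : Set C)
  mul_mem : ∀ {t s : G} {x y : C}, x ∈ fiber t → y ∈ fiber s → x * y ∈ fiber (t * s)
  star_mem : ∀ {t : G} {x : C}, x ∈ fiber t → star x ∈ fiber t⁻¹
  isInternal : DirectSum.IsInternal fiber

/-- A C*-algebraic bundle is saturated if the closed span of `A_t A_t*` is
`A_e` for every `t`. -/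
def CStarBundle.Saturated {G : Type*} [Group G] [DecidableEq G] {C : Type*}
    [NormedRing C] [StarRing C] [NormedAlgebra ℂ C] (𝒜 : CStarBundle G C) : Prop :=
  ∀ t, (Submodule.span ℂ
      {x : C | ∃ a ∈ 𝒜.fiber t, ∃ b ∈ 𝒜.fiber t, x = a * star b}).topologicalClosure
    = 𝒜.fiber 1

/-- The data of an equivalence bundle in the sense of Abadie–Ferraro between
two C*-algebraic bundles with fibers `Afib` (inside `C`) and `Bfib` (inside
`D`):  a grading `{X_t}_{t ∈ G}` of the `C`-`D`-bimodule `Y = ⊕_{t∈G} X_t`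
which is compatible with the two bundle gradings (conditions (1R)-(7R) and
(1L)-(7L) of Abadie–Ferraro). -/
structure EquivBundleData {G : Type*} [Group G] [DecidableEq G] {C D Y : Type*}
    [NormedRing C] [StarRing C] [NormedAlgebra ℂ C]
    [NormedRing D] [StarRing D] [NormedAlgebra ℂ D]
    [NormedAddCommGroup Y]
    (Afib : G → Submodule ℂ C) (Bfib : G → Submodule ℂ D)
    (E : HilbertBimod C D Y) where
  fiber : G → AddSubgroup Y
  fiber_closed : ∀ t, IsClosed (fiber t : Set Y)
  isInternal : DirectSum.IsInternal fiber
  lsmul_mem : ∀ {t s : G} {c : C} {x : Y}, c ∈ Afib t → x ∈ fiber s →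
    E.lsmul c x ∈ fiber (t * s)
  rsmul_mem : ∀ {t s : G} {x : Y} {d : D}, x ∈ fiber t → d ∈ Bfib s →
    E.rsmul x d ∈ fiber (t * s)
  linner_mem : ∀ {t s : G} {x y : Y}, x ∈ fiber t → y ∈ fiber s →
    E.linner x y ∈ Afib (t * s⁻¹)
  rinner_mem : ∀ {t s : G} {x y : Y}, x ∈ fiber t → y ∈ fiber s →
    E.rinner x y ∈ Bfib (t⁻¹ * s)

/-- The strengthened fullness conditions `⟨X_t , X_s⟩_C = A_{ts⁻¹}` and
`⟨X_t , X_s⟩_D = B_{t⁻¹s}` for an equivalence bundle. -/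
def EquivBundleData.StrictSpan {G : Type*} [Group G] [DecidableEq G] {C D Y : Type*}
    [NormedRing C] [StarRing C] [NormedAlgebra ℂ C]
    [NormedRing D] [StarRing D] [NormedAlgebra ℂ D]
    [NormedAddCommGroup Y]
    {Afib : G → Submodule ℂ C} {Bfib : G → Submodule ℂ D}
    {E : HilbertBimod C D Y} (Z : EquivBundleData Afib Bfib E) : Prop :=
  (∀ t s : G, Submodule.span ℂ
      {c : C | ∃ x ∈ Z.fiber t, ∃ y ∈ Z.fiber s, c = E.linner x y} = Afib (t * s⁻¹)) ∧
  (∀ t s : G, Submodule.span ℂ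
      {d : D | ∃ x ∈ Z.fiber t, ∃ y ∈ Z.fiber s, d = E.rinner x y} = Bfib (t⁻¹ * s))

/-- A witness of strong Morita equivalence of the unital inclusions
`A ⊆ C` and `B ⊆ D`:  a `C`-`D`-equivalence bimodule `Y` together with a
closed subspace `X₀ ⊆ Y` which is an `A`-`B`-equivalence bimodule and such
that `⟨Y , X₀⟩_C` is dense in `C` and `⟨Y , X₀⟩_D` is dense in `D`. -/
structure MoritaIncl (C D : Type*)
    [NormedRing C] [StarRing C] [NormedAlgebra ℂ C]
    [NormedRing D] [StarRing D] [NormedAlgebra ℂ D]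
    (A : Submodule ℂ C) (B : Submodule ℂ D) where
  Y : Type
  [instN : NormedAddCommGroup Y]
  [instC : CompleteSpace Y]
  E : HilbertBimod C D Y
  lFull : E.LFull
  rFull : E.RFull
  X₀ : AddSubgroup Y
  closed_X₀ : IsClosed (X₀ : Set Y)
  lsmul_mem : ∀ {a : C} {x : Y}, a ∈ A → x ∈ X₀ → E.lsmul a x ∈ X₀
  rsmul_mem : ∀ {x : Y} {b : D}, x ∈ X₀ → b ∈ B → E.rsmul x b ∈ X₀
  linner_mem : ∀ {x y : Y}, x ∈ X₀ → y ∈ X₀ → E.linner x y ∈ A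
  rinner_mem : ∀ {x y : Y}, x ∈ X₀ → y ∈ X₀ → E.rinner x y ∈ B
  linner_full : (Submodule.span ℂ
      {c : C | ∃ x ∈ X₀, ∃ y ∈ X₀, c = E.linner x y}).topologicalClosure = A
  rinner_full : (Submodule.span ℂ
      {d : D | ∃ x ∈ X₀, ∃ y ∈ X₀, d = E.rinner x y}).topologicalClosure = B
  linner_span : (Submodule.span ℂ
      {c : C | ∃ y : Y, ∃ x ∈ X₀, c = E.linner y x}).topologicalClosure = ⊤
  rinner_span : (Submodule.span ℂ
      {d : D | ∃ y : Y, ∃ x ∈ X₀, d = E.rinner y x}).topologicalClosure = ⊤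

/-- Strong Morita equivalence of the unital inclusions `A ⊆ C` and `B ⊆ D`. -/
def StronglyMoritaEquivalentIncl (C D : Type*)
    [NormedRing C] [StarRing C] [NormedAlgebra ℂ C]
    [NormedRing D] [StarRing D] [NormedAlgebra ℂ D]
    (A : Submodule ℂ C) (B : Submodule ℂ D) : Prop :=
  Nonempty (MoritaIncl C D A B)

/-- The data exhibiting the Hilbert `B`-`A`-bimodule `X'` as the dual
(conjugate) bimodule `X̃` of the Hilbert `A`-`B`-bimodule `X`, via the
conjugation map `x ↦ x̃`. -/
structure DualData {A B X X' : Type*}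
    [NormedRing A] [StarRing A] [NormedRing B] [StarRing B]
    [NormedAddCommGroup X] [NormedAddCommGroup X']
    (E : HilbertBimod A B X) (F : HilbertBimod B A X') where
  conj : X → X'
  conj_add : ∀ x y, conj (x + y) = conj x + conj y
  conj_bijective : Function.Bijective conj
  lsmul_conj : ∀ (b : B) (x : X), F.lsmul b (conj x) = conj (E.rsmul x (star b))
  rsmul_conj : ∀ (x : X) (a : A), F.rsmul (conj x) a = conj (E.lsmul (star a) x)
  linner_conj : ∀ x y : X, F.linner (conj x) (conj y) = E.rinner x y
  rinner_conj : ∀ x y : X, F.rinner (conj x) (conj y) = E.linner x y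
  norm_conj : ∀ x : X, ‖conj x‖ = ‖x‖

/-- The data exhibiting the Hilbert `A`-`C`-bimodule `T` as the interior
tensor product `X ⊗_B Y` of the Hilbert `A`-`B`-bimodule `X` and the Hilbert
`B`-`C`-bimodule `Y`. -/
structure TensorData {A B C X Y T : Type*}
    [NormedRing A] [StarRing A] [NormedRing B] [StarRing B]
    [NormedRing C] [StarRing C]
    [NormedAddCommGroup X] [NormedAddCommGroup Y] [NormedAddCommGroup T]
    (E : HilbertBimod A B X) (F : HilbertBimod B C Y)
    (G : HilbertBimod A C T) where
  tmul : X → Y → T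
  tmul_add_left : ∀ x x' y, tmul (x + x') y = tmul x y + tmul x' y
  tmul_add_right : ∀ x y y', tmul x (y + y') = tmul x y + tmul x y'
  tmul_balanced : ∀ (x : X) (b : B) (y : Y),
    tmul (E.rsmul x b) y = tmul x (F.lsmul b y)
  lsmul_tmul : ∀ (a : A) (x : X) (y : Y),
    G.lsmul a (tmul x y) = tmul (E.lsmul a x) y
  rsmul_tmul : ∀ (x : X) (y : Y) (c : C),
    G.rsmul (tmul x y) c = tmul x (F.rsmul y c)
  linner_tmul : ∀ (x x' : X) (y y' : Y),
    G.linner (tmul x y) (tmul x' y') = E.linner (E.rsmul x (F.linner y y')) x'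
  rinner_tmul : ∀ (x x' : X) (y y' : Y),
    G.rinner (tmul x y) (tmul x' y') = F.rinner y (F.lsmul (E.rinner x x') y')
  tmul_dense : Dense
    ((AddSubgroup.closure {t : T | ∃ x y, t = tmul x y} : AddSubgroup T) : Set T)

/-- An involution on a Hilbert `A`-`A`-bimodule, making it an involutive
Hilbert bimodule:  a conjugate-linear map `x ↦ x^♮` with `(x^♮)^♮ = x`,
`(a·x·b)^♮ = b*·x^♮·a*` and `⟨x , y^♮⟩_A = ⟨x^♮ , y⟩_A` (the left inner
product of `x` with `y^♮` equals the right inner product of `x^♮` with `y`). -/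
structure Involution {A X : Type*} [NormedRing A] [StarRing A]
    [NormedAddCommGroup X] (E : HilbertBimod A A X) where
  invol : X → X
  invol_add : ∀ x y, invol (x + y) = invol x + invol y
  invol_invol : ∀ x, invol (invol x) = x
  invol_lsmul : ∀ (a : A) (x : X), invol (E.lsmul a x) = E.rsmul (invol x) (star a)
  invol_rsmul : ∀ (x : X) (a : A), invol (E.rsmul x a) = E.lsmul (star a) (invol x)
  linner_invol : ∀ x y : X, E.linner x (invol y) = E.rinner (invol x) y

/-- `φ : X → X'` is an isomorphism of Hilbert `A`-`B`-bimodules from `E`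
onto `F`. -/
structure IsBimodIso {A B X X' : Type*}
    [NormedRing A] [StarRing A] [NormedRing B] [StarRing B]
    [NormedAddCommGroup X] [NormedAddCommGroup X']
    (E : HilbertBimod A B X) (F : HilbertBimod A B X') (φ : X → X') : Prop where
  map_add : ∀ x y, φ (x + y) = φ x + φ y
  bijective : Function.Bijective φ
  map_lsmul : ∀ (a : A) (x : X), φ (E.lsmul a x) = F.lsmul a (φ x)
  map_rsmul : ∀ (x : X) (b : B), φ (E.rsmul x b) = F.rsmul (φ x) b
  map_linner : ∀ x y : X, F.linner (φ x) (φ y) = E.linner x y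
  map_rinner : ∀ x y : X, F.rinner (φ x) (φ y) = E.rinner x y

/-- The data exhibiting the unital C*-algebra `C` as the total C*-algebra
`C_X ≅ A ⊕ X` of the C*-algebraic bundle over `ℤ₂` induced by an involutive
Hilbert `A`-`A`-bimodule `X`:  `C = ιA(A) ⊕ ιX(X)` with
`ιA(a) ιX(x) = ιX(a·x)`, `ιX(x) ιA(a) = ιX(x·a)`,
`ιX(x) ιX(y) = ιA(⟨x , y^♮⟩_A)` and `ιX(x)* = ιX(x^♮)`. -/
structure InvolBundleAlg {A X : Type*} [CStarAlgebra A] [NormedAddCommGroup X]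
    (E : HilbertBimod A A X) (J : Involution E)
    (C : Type*) [CStarAlgebra C] where
  ιA : A →⋆ₐ[ℂ] C
  ιX : X →+ C
  sum_bijective : Function.Bijective (fun p : A × X => ιA p.1 + ιX p.2)
  smul_range : ∀ (z : ℂ) (x : X), ∃ x' : X, ιX x' = z • ιX x
  mul_AX : ∀ (a : A) (x : X), ιA a * ιX x = ιX (E.lsmul a x)
  mul_XA : ∀ (x : X) (a : A), ιX x * ιA a = ιX (E.rsmul x a)
  mul_XX : ∀ x y : X, ιX x * ιX y = ιA (E.linner x (J.invol y))
  star_X : ∀ x : X, star (ιX x) = ιX (J.invol x)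
  norm_A : ∀ a : A, ‖ιA a‖ = ‖a‖
  norm_X : ∀ x : X, ‖ιX x‖ = ‖x‖

variable {A B X Y : Type} [CStarAlgebra A] [CStarAlgebra B]
  [NormedAddCommGroup X] [NormedAddCommGroup Y]
  {C D : Type} [CStarAlgebra C] [CStarAlgebra D]

/-- An `A`-`B`-equivalence bimodule `M` together with an isomorphism
`Y ≅ M̃ ⊗_A X ⊗_A M` of involutive Hilbert `B`-`B`-bimodules. -/
structure ModuleSideZ2 (EX : HilbertBimod A A X) (JX : Involution EX)
    (EY : HilbertBimod B B Y) (JY : Involution EY) where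
  M : Type
  [instM : NormedAddCommGroup M]
  [instMC : CompleteSpace M]
  EM : HilbertBimod A B M
  lFull : EM.LFull
  rFull : EM.RFull
  M' : Type
  [instM' : NormedAddCommGroup M']
  EM' : HilbertBimod B A M'
  DD : DualData EM EM'
  T₁ : Type
  [instT₁ : NormedAddCommGroup T₁]
  G₁ : HilbertBimod B A T₁
  TD₁ : TensorData EM' EX G₁
  T : Type
  [instT : NormedAddCommGroup T]
  GT : HilbertBimod B B T
  TD : TensorData G₁ EM GT
  JT : Involution GT
  hJT : ∀ (m n : M) (x : X),
    JT.invol (TD.tmul (TD₁.tmul (DD.conj m) x) n)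
      = TD.tmul (TD₁.tmul (DD.conj n) (JX.invol x)) m
  Φ : T → Y
  hΦ : IsBimodIso GT EY Φ
  hΦJ : ∀ ξ : T, Φ (JT.invol ξ) = JY.invol (Φ ξ)

/-- The algebraic part of a Hilbert `C`-`D`-bimodule, with no norm on the underlying group. -/
structure PreHilbertBimod (C D Z : Type) [CStarAlgebra C] [CStarAlgebra D] [AddCommGroup Z] where
  lsmul : C → Z → Z
  rsmul : Z → D → Z
  linner : Z → Z → C
  rinner : Z → Z → D
  lsmul_add : ∀ c x y, lsmul c (x + y) = lsmul c x + lsmul c y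
  add_lsmul : ∀ c c' x, lsmul (c + c') x = lsmul c x + lsmul c' x
  mul_lsmul : ∀ c c' x, lsmul (c * c') x = lsmul c (lsmul c' x)
  one_lsmul : ∀ x, lsmul 1 x = x
  rsmul_add : ∀ x y d, rsmul (x + y) d = rsmul x d + rsmul y d
  add_rsmul : ∀ x d d', rsmul x (d + d') = rsmul x d + rsmul x d'
  rsmul_mul : ∀ x d d', rsmul x (d * d') = rsmul (rsmul x d) d'
  rsmul_one : ∀ x, rsmul x 1 = x
  lsmul_rsmul : ∀ c x d, rsmul (lsmul c x) d = lsmul c (rsmul x d)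
  linner_add_left : ∀ x y z, linner (x + y) z = linner x z + linner y z
  linner_add_right : ∀ x y z, linner x (y + z) = linner x y + linner x z
  linner_lsmul_left : ∀ c x y, linner (lsmul c x) y = c * linner x y
  linner_star : ∀ x y, star (linner x y) = linner y x
  rinner_add_left : ∀ x y z, rinner (x + y) z = rinner x z + rinner y z
  rinner_add_right : ∀ x y z, rinner x (y + z) = rinner x y + rinner x z
  rinner_rsmul_right : ∀ x y d, rinner x (rsmul y d) = rinner x y * d
  rinner_star : ∀ x y, star (rinner x y) = rinner y x
  inner_assoc : ∀ x y z, lsmul (linner x y) z = rsmul x (rinner y z)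

namespace PreHilbertBimod

variable {Z : Type} [AddCommGroup Z] (H : PreHilbertBimod C D Z)

/-- The conjugate bimodule, on the same underlying group. -/
def dual : PreHilbertBimod D C Z where
  lsmul d x := H.rsmul x (star d)
  rsmul x c := H.lsmul (star c) x
  linner := H.rinner
  rinner := H.linner
  lsmul_add c x y := H.rsmul_add x y _
  add_lsmul c c' x := by rw [star_add, H.add_rsmul]
  mul_lsmul c c' x := by rw [star_mul, H.rsmul_mul]
  one_lsmul x := by rw [star_one, H.rsmul_one]
  rsmul_add x y d := H.lsmul_add _ x y
  add_rsmul x d d' := by rw [star_add, H.add_lsmul]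
  rsmul_mul x d d' := by rw [star_mul, H.mul_lsmul]
  rsmul_one x := by rw [star_one, H.one_lsmul]
  lsmul_rsmul c x d := (H.lsmul_rsmul _ x _).symm
  linner_add_left := H.rinner_add_left
  linner_add_right := H.rinner_add_right
  linner_lsmul_left c x y := by
    rw [← H.rinner_star, H.rinner_rsmul_right, star_mul, star_star, H.rinner_star]
  linner_star := H.rinner_star
  rinner_add_left := H.linner_add_left
  rinner_add_right := H.linner_add_right
  rinner_rsmul_right x y d := by
    rw [← H.linner_star, H.linner_lsmul_left, star_mul, star_star, H.linner_star]
  rinner_star := H.linner_star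
  inner_assoc x y z := by rw [H.rinner_star, H.linner_star, H.inner_assoc]

lemma rinner_rsmul_left (x y : Z) (d : D) : H.rinner (H.rsmul x d) y = star d * H.rinner x y := by
  simpa [dual] using H.dual.linner_lsmul_left (star d) x y

lemma linner_lsmul_right (c : C) (x y : Z) :
    H.linner x (H.lsmul c y) = H.linner x y * star c := by
  simpa [dual] using H.dual.rinner_rsmul_right x y (star c)

/-- Left multiplication by a fixed vector, as an additive map in the scalar. -/
def lsmulRight (x : Z) : C →+ Z := AddMonoidHom.mk' (fun c => H.lsmul c x) fun c c' => H.add_lsmul c c' x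

/-- Left multiplication by a fixed scalar, as an additive map. -/
def lsmulLeft (c : C) : Z →+ Z := AddMonoidHom.mk' (H.lsmul c) (H.lsmul_add c)

/-- Right multiplication of a fixed vector, as an additive map in the scalar. -/
def rsmulLeft (x : Z) : D →+ Z := AddMonoidHom.mk' (H.rsmul x) (H.add_rsmul x)

/-- Right multiplication by a fixed scalar, as an additive map. -/
def rsmulRight (d : D) : Z →+ Z := AddMonoidHom.mk' (fun x => H.rsmul x d) fun x y => H.rsmul_add x y d

/-- The left inner product as an additive map in the first variable. -/
def linnerLeft (y : Z) : Z →+ C :=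
  AddMonoidHom.mk' (fun x => H.linner x y) fun x x' => H.linner_add_left x x' y

/-- The left inner product as an additive map in the second variable. -/
def linnerRight (x : Z) : Z →+ C := AddMonoidHom.mk' (H.linner x) (H.linner_add_right x)

/-- The right inner product as an additive map in the first variable. -/
def rinnerLeft (y : Z) : Z →+ D :=
  AddMonoidHom.mk' (fun x => H.rinner x y) fun x x' => H.rinner_add_left x x' y

/-- The right inner product as an additive map in the second variable. -/
def rinnerRight (x : Z) : Z →+ D := AddMonoidHom.mk' (H.rinner x) (H.rinner_add_right x)

lemma lsmul_neg (c : C) (x : Z) : H.lsmul c (-x) = -H.lsmul c x := map_neg (H.lsmulLeft c) x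
lemma lsmul_zero (c : C) : H.lsmul c 0 = 0 := map_zero (H.lsmulLeft c)
lemma sub_lsmul (c c' : C) (x : Z) : H.lsmul (c - c') x = H.lsmul c x - H.lsmul c' x :=
  map_sub (H.lsmulRight x) c c'
lemma neg_lsmul (c : C) (x : Z) : H.lsmul (-c) x = -H.lsmul c x := map_neg (H.lsmulRight x) c
lemma zero_lsmul (x : Z) : H.lsmul 0 x = 0 := map_zero (H.lsmulRight x)
lemma rsmul_sub (x : Z) (d d' : D) : H.rsmul x (d - d') = H.rsmul x d - H.rsmul x d' :=
  map_sub (H.rsmulLeft x) d d'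
lemma rsmul_neg (x : Z) (d : D) : H.rsmul x (-d) = -H.rsmul x d := map_neg (H.rsmulLeft x) d
lemma rsmul_zero (x : Z) : H.rsmul x 0 = 0 := map_zero (H.rsmulLeft x)
lemma sub_rsmul (x y : Z) (d : D) : H.rsmul (x - y) d = H.rsmul x d - H.rsmul y d :=
  map_sub (H.rsmulRight d) x y
lemma neg_rsmul (x : Z) (d : D) : H.rsmul (-x) d = -H.rsmul x d := map_neg (H.rsmulRight d) x
lemma zero_rsmul (d : D) : H.rsmul 0 d = 0 := map_zero (H.rsmulRight d)
lemma linner_sub_left (x y z : Z) : H.linner (x - y) z = H.linner x z - H.linner y z :=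
  map_sub (H.linnerLeft z) x y
lemma linner_neg_left (x y : Z) : H.linner (-x) y = -H.linner x y := map_neg (H.linnerLeft y) x
lemma linner_neg_right (x y : Z) : H.linner x (-y) = -H.linner x y := map_neg (H.linnerRight x) y
lemma linner_zero_left (y : Z) : H.linner 0 y = 0 := map_zero (H.linnerLeft y)
lemma rinner_neg_left (x y : Z) : H.rinner (-x) y = -H.rinner x y := map_neg (H.rinnerLeft y) x
lemma rinner_neg_right (x y : Z) : H.rinner x (-y) = -H.rinner x y := map_neg (H.rinnerRight x) y
lemma rinner_zero_left (y : Z) : H.rinner 0 y = 0 := map_zero (H.rinnerLeft y)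
lemma rinner_zero_right (x : Z) : H.rinner x 0 = 0 := map_zero (H.rinnerRight x)

variable {ι : Type*} (s : Finset ι)

lemma lsmul_sum (c : C) (f : ι → Z) : H.lsmul c (∑ i ∈ s, f i) = ∑ i ∈ s, H.lsmul c (f i) :=
  map_sum (H.lsmulLeft c) f s
lemma sum_lsmul (f : ι → C) (x : Z) : H.lsmul (∑ i ∈ s, f i) x = ∑ i ∈ s, H.lsmul (f i) x :=
  map_sum (H.lsmulRight x) f s
lemma rsmul_sum (x : Z) (f : ι → D) : H.rsmul x (∑ i ∈ s, f i) = ∑ i ∈ s, H.rsmul x (f i) :=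
  map_sum (H.rsmulLeft x) f s
lemma sum_rsmul (f : ι → Z) (d : D) : H.rsmul (∑ i ∈ s, f i) d = ∑ i ∈ s, H.rsmul (f i) d :=
  map_sum (H.rsmulRight d) f s
lemma linner_sum_left (f : ι → Z) (y : Z) :
    H.linner (∑ i ∈ s, f i) y = ∑ i ∈ s, H.linner (f i) y := map_sum (H.linnerLeft y) f s
lemma rinner_sum_right (x : Z) (f : ι → Z) :
    H.rinner x (∑ i ∈ s, f i) = ∑ i ∈ s, H.rinner x (f i) := map_sum (H.rinnerRight x) f s

/-- A finite family witnessing `1 = ∑ ⟨u i, v i⟩_C`. -/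
def IsLFrame {k : ℕ} (u v : Fin k → Z) : Prop := ∑ i, H.linner (u i) (v i) = 1

/-- A finite family witnessing `1 = ∑ ⟨u i, v i⟩_D`. -/
def IsRFrame {k : ℕ} (u v : Fin k → Z) : Prop := ∑ i, H.rinner (u i) (v i) = 1

variable {H} in
lemma IsLFrame.symm {k : ℕ} {u v : Fin k → Z} (h : H.IsLFrame u v) : H.IsLFrame v u := by
  have := congrArg star h
  simpa [IsLFrame, H.linner_star] using this

variable {H} in
lemma IsRFrame.symm {k : ℕ} {u v : Fin k → Z} (h : H.IsRFrame u v) : H.IsRFrame v u := by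
  have := congrArg star h
  simpa [IsRFrame, H.rinner_star] using this

variable {H} in
lemma IsLFrame.expand {k : ℕ} {u v : Fin k → Z} (h : H.IsLFrame u v) (z : Z) :
    z = ∑ i, H.rsmul (u i) (H.rinner (v i) z) := by
  conv_lhs => rw [← H.one_lsmul z, ← h, H.sum_lsmul]
  exact Finset.sum_congr rfl fun i _ => H.inner_assoc _ _ _

variable {H} in
lemma IsRFrame.expand {k : ℕ} {u v : Fin k → Z} (h : H.IsRFrame u v) (z : Z) :
    z = ∑ i, H.lsmul (H.linner z (u i)) (v i) := by
  conv_lhs => rw [← H.rsmul_one z, ← h, H.rsmul_sum]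
  exact Finset.sum_congr rfl fun i _ => (H.inner_assoc _ _ _).symm

variable {H} in
lemma IsRFrame.faithful {k : ℕ} {u v : Fin k → Z} (h : H.IsRFrame u v) {d d' : D}
    (hd : ∀ i, H.rsmul (v i) d = H.rsmul (v i) d') : d = d' := by
  rw [← one_mul d, ← one_mul d', ← h, Finset.sum_mul, Finset.sum_mul]
  exact Finset.sum_congr rfl fun i _ => by
    rw [← H.rinner_rsmul_right, ← H.rinner_rsmul_right, hd]

variable {H} in
lemma IsLFrame.faithful {k : ℕ} {u v : Fin k → Z} (h : H.IsLFrame u v) {c c' : C}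
    (hc : ∀ i, H.lsmul c (u i) = H.lsmul c' (u i)) : c = c' := by
  rw [← mul_one c, ← mul_one c', ← h, Finset.mul_sum, Finset.mul_sum]
  exact Finset.sum_congr rfl fun i _ => by
    rw [← H.linner_lsmul_left, ← H.linner_lsmul_left, hc]

/-- Real scalars act in the same way from both sides. -/
def RealCompat : Prop :=
  ∀ (r : ℝ) (z : Z), H.lsmul (algebraMap ℝ C r) z = H.rsmul z (algebraMap ℝ D r)

variable {H}

lemma RealCompat.dual (h : H.RealCompat) : H.dual.RealCompat := fun r z => by
  simp only [PreHilbertBimod.dual, ← algebraMap_star_comm]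
  simpa using (h r z).symm

lemma isUnit_sub_linner (hH : H.RealCompat) {r : ℝ} (hr : r ≠ 0) {x y : Z}
    (h : IsUnit (algebraMap ℝ D r - H.rinner y x)) :
    IsUnit (algebraMap ℝ C r - H.linner x y) := by
  obtain ⟨w, hw, hw'⟩ := isUnit_iff_exists.mp h
  have e1 : H.linner x y = algebraMap ℝ C r * H.linner (H.rsmul x w) y
      - H.linner x y * H.linner (H.rsmul x w) y := by
    have : H.rsmul (H.rsmul x (algebraMap ℝ D r - H.rinner y x)) w = x := by
      rw [← H.rsmul_mul, hw, H.rsmul_one]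
    rw [H.rsmul_sub, ← hH, ← H.inner_assoc, H.sub_rsmul, H.lsmul_rsmul, H.lsmul_rsmul] at this
    rw [← H.linner_lsmul_left, ← H.linner_lsmul_left, ← H.linner_sub_left, this]
  have e2 : H.linner x y = algebraMap ℝ C r * H.linner (H.rsmul x w) y
      - H.linner (H.rsmul x w) y * H.linner x y := by
    have : H.rsmul (H.rsmul x w) (algebraMap ℝ D r - H.rinner y x) = x := by
      rw [← H.rsmul_mul, hw', H.rsmul_one]
    rw [H.rsmul_sub, ← hH, ← H.inner_assoc] at this
    rw [← H.linner_lsmul_left, ← H.linner_lsmul_left, ← H.linner_sub_left, this]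
  generalize H.linner x y = p at *
  generalize H.linner (H.rsmul x w) y = q at *
  have hi : algebraMap ℝ C r⁻¹ * algebraMap ℝ C r = 1 := by
    rw [← map_mul, inv_mul_cancel₀ hr, map_one]
  refine isUnit_iff_exists.mpr ⟨algebraMap ℝ C r⁻¹ * (1 + q), ?_, ?_⟩
  · have : (algebraMap ℝ C r - p) * (1 + q) = algebraMap ℝ C r := by
      rw [mul_add, mul_one, sub_mul, ← e1, sub_add_cancel]
    rw [← mul_assoc, ← Algebra.commutes, mul_assoc, this, hi]
  · have : (1 + q) * (algebraMap ℝ C r - p) = algebraMap ℝ C r := by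
      rw [add_mul, one_mul, mul_sub, ← Algebra.commutes r q, ← e2]; simp
    rw [mul_assoc, this, hi]

lemma mem_spectrum_rinner (hH : H.RealCompat) {r : ℝ} (hr : r ≠ 0) {x y : Z}
    (h : r ∈ spectrum ℝ (H.linner x y)) : r ∈ spectrum ℝ (H.rinner y x) :=
  fun h' => h (isUnit_sub_linner hH hr h')

lemma norm_linner_le_of_isSelfAdjoint (hH : H.RealCompat) {x y : Z}
    (h : IsSelfAdjoint (H.linner x y)) : ‖H.linner x y‖ ≤ ‖H.rinner y x‖ := by
  rcases eq_or_ne (H.linner x y) 0 with h0 | h0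
  · simp [h0]
  have : Nontrivial C := ⟨_, _, h0⟩
  have hD : Nontrivial D := by
    by_contra hD
    rw [not_nontrivial_iff_subsingleton] at hD
    have e : H.lsmul (H.linner x y) x = H.lsmul 0 x := by
      rw [H.inner_assoc, Subsingleton.elim (H.rinner y x) 0, H.rsmul_zero, H.zero_lsmul]
    have hx : x = 0 := by
      rw [← H.rsmul_one x, Subsingleton.elim (1 : D) 0, H.rsmul_zero]
    exact h0 (by rw [hx, H.linner_zero_left])
  have key : ∀ t : ℝ, |t| = ‖H.linner x y‖ → t ∈ spectrum ℝ (H.linner x y) →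
      ‖H.linner x y‖ ≤ ‖H.rinner y x‖ := fun t ht hmem => by
    have ht0 : t ≠ 0 := by
      rintro rfl; simp at ht; exact h0 (norm_eq_zero.mp ht.symm)
    have := spectrum.norm_le_norm_of_mem (mem_spectrum_rinner hH ht0 hmem)
    rwa [Real.norm_eq_abs, ht] at this
  rcases CStarAlgebra.norm_or_neg_norm_mem_spectrum h with hm | hm
  · exact key _ (by simp) hm
  · exact key _ (by simp) hm

lemma norm_rinner_le_of_isSelfAdjoint (hH : H.RealCompat) {x y : Z}
    (h : IsSelfAdjoint (H.rinner x y)) : ‖H.rinner x y‖ ≤ ‖H.linner y x‖ :=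
  norm_linner_le_of_isSelfAdjoint (H := H.dual) hH.dual h

lemma norm_linner_self_eq (hH : H.RealCompat) (x : Z) : ‖H.linner x x‖ = ‖H.rinner x x‖ :=
  (norm_linner_le_of_isSelfAdjoint hH (H.linner_star x x)).antisymm
    (norm_rinner_le_of_isSelfAdjoint hH (H.rinner_star x x))

/-- The Cauchy–Schwarz inequality; positivity of the inner products is not needed. -/
lemma norm_rinner_sq_le (hH : H.RealCompat) (x y : Z) :
    ‖H.rinner x y‖ ^ 2 ≤ ‖H.rinner x x‖ * ‖H.rinner y y‖ := by
  have e : star (H.rinner x y) * H.rinner x y = H.rinner y (H.lsmul (H.linner x x) y) := by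
    rw [H.inner_assoc, H.rinner_rsmul_right, H.rinner_star]
  have hs : IsSelfAdjoint (H.rinner y (H.lsmul (H.linner x x) y)) := by
    rw [← e]; exact IsSelfAdjoint.star_mul_self _
  calc ‖H.rinner x y‖ ^ 2 = ‖H.rinner y (H.lsmul (H.linner x x) y)‖ := by
        rw [← e, CStarRing.norm_star_mul_self, sq]
    _ ≤ ‖H.linner (H.lsmul (H.linner x x) y) y‖ := norm_rinner_le_of_isSelfAdjoint hH hs
    _ ≤ ‖H.linner x x‖ * ‖H.linner y y‖ := by rw [H.linner_lsmul_left]; exact norm_mul_le _ _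
    _ = _ := by rw [norm_linner_self_eq hH, norm_linner_self_eq hH]

/-- The norm of a vector, computed from the right inner product. -/
def vnorm (H : PreHilbertBimod C D Z) (x : Z) : ℝ := Real.sqrt ‖H.rinner x x‖

lemma vnorm_nonneg (x : Z) : 0 ≤ H.vnorm x := Real.sqrt_nonneg _

lemma vnorm_sq (x : Z) : H.vnorm x ^ 2 = ‖H.rinner x x‖ := Real.sq_sqrt (norm_nonneg _)

lemma norm_rinner_le (hH : H.RealCompat) (x y : Z) :
    ‖H.rinner x y‖ ≤ H.vnorm x * H.vnorm y := by
  refine abs_le_of_sq_le_sq' ?_ (mul_nonneg (vnorm_nonneg _) (vnorm_nonneg _)) |>.2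
  rw [mul_pow, vnorm_sq, vnorm_sq]
  exact norm_rinner_sq_le hH x y

lemma vnorm_add_le (hH : H.RealCompat) (x y : Z) : H.vnorm (x + y) ≤ H.vnorm x + H.vnorm y := by
  refine abs_le_of_sq_le_sq' ?_ (add_nonneg (vnorm_nonneg _) (vnorm_nonneg _)) |>.2
  rw [vnorm_sq, H.rinner_add_left, H.rinner_add_right, H.rinner_add_right]
  have h1 := norm_add_le (H.rinner x x + H.rinner x y) (H.rinner y x + H.rinner y y)
  have h2 := norm_add_le (H.rinner x x) (H.rinner x y)
  have h3 := norm_add_le (H.rinner y x) (H.rinner y y)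
  have h4 := norm_rinner_le hH x y
  have h5 := norm_rinner_le hH y x
  rw [← vnorm_sq] at h2 h3
  nlinarith

lemma rinner_eq_zero_of_self (hH : H.RealCompat) {x : Z} (h : H.rinner x x = 0) (y : Z) :
    H.rinner y x = 0 := by
  have := norm_rinner_sq_le hH y x
  rw [h, norm_zero, mul_zero] at this
  exact norm_eq_zero.mp (pow_eq_zero_iff two_ne_zero |>.mp (this.antisymm (sq_nonneg _)))

lemma vnorm_rsmul_le (x : Z) (d : D) : H.vnorm (H.rsmul x d) ≤ H.vnorm x * ‖d‖ := by
  refine abs_le_of_sq_le_sq' ?_ (mul_nonneg (vnorm_nonneg _) (norm_nonneg _)) |>.2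
  rw [mul_pow, vnorm_sq, vnorm_sq, H.rinner_rsmul_right, H.rinner_rsmul_left]
  calc _ ≤ ‖star d‖ * ‖H.rinner x x‖ * ‖d‖ :=
        (norm_mul_le _ _).trans (mul_le_mul_of_nonneg_right (norm_mul_le _ _) (norm_nonneg _))
    _ = _ := by rw [norm_star]; ring

/-- The norm of a bimodule with a left frame. -/
def vectorNorm (hH : H.RealCompat) {k : ℕ} {u v : Fin k → Z} (hf : H.IsLFrame u v) :
    AddGroupNorm Z where
  toFun := H.vnorm
  map_zero' := by simp [vnorm, H.rinner_zero_left]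
  add_le' := vnorm_add_le hH
  neg' x := by simp [vnorm, H.rinner_neg_left, H.rinner_neg_right]
  eq_zero_of_map_eq_zero' x hx := by
    have h0 : H.rinner x x = 0 := by
      rw [← norm_eq_zero, ← vnorm_sq, hx]; simp
    rw [hf.expand x]
    exact Finset.sum_eq_zero fun i _ => by rw [rinner_eq_zero_of_self hH h0, H.rsmul_zero]

/-- A bimodule with a left frame is a Hilbert bimodule for its vector norm. -/
def toHilbertBimod (hH : H.RealCompat) {k : ℕ} {u v : Fin k → Z} (hf : H.IsLFrame u v) :
    letI := (vectorNorm hH hf).toNormedAddCommGroup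
    HilbertBimod C D Z :=
  letI := (vectorNorm hH hf).toNormedAddCommGroup
  { H with
    norm_linner_self := fun x => by
      rw [norm_linner_self_eq hH, ← vnorm_sq]; rfl
    norm_rinner_self := fun x => (vnorm_sq x).symm }

lemma completeSpace (hH : H.RealCompat) {k : ℕ} {u v : Fin k → Z} (hf : H.IsLFrame u v) :
    letI := (vectorNorm hH hf).toNormedAddCommGroup
    CompleteSpace Z := by
  let := (vectorNorm hH hf).toNormedAddCommGroup
  have hr : ∀ x : Z, Continuous (H.rsmulLeft x) := fun x =>
    AddMonoidHomClass.continuous_of_bound _ (H.vnorm x) fun d => vnorm_rsmul_le x d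
  have hi : ∀ x y : Z, ‖H.rinner x y‖ ≤ H.vnorm x * ‖y‖ := norm_rinner_le hH
  refine Metric.complete_of_cauchySeq_tendsto fun z hz => ?_
  have hc : ∀ i, CauchySeq fun n => H.rinner (v i) (z n) := fun i =>
    (AddMonoidHomClass.lipschitz_of_bound (H.rinnerRight (v i)) _
      (hi (v i))).uniformContinuous.comp_cauchySeq hz
  choose d hd using fun i => cauchySeq_tendsto_of_complete (hc i)
  refine ⟨∑ i, H.rsmul (u i) (d i), ?_⟩
  have : z = fun n => ∑ i, H.rsmul (u i) (H.rinner (v i) (z n)) := funext fun n => hf.expand _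
  rw [this]
  exact tendsto_finsetSum _ fun i _ => ((hr (u i)).tendsto _).comp (hd i)

end PreHilbertBimod

/-- The algebraic part of a Hilbert bimodule. -/
def HilbertBimod.toPre {Z : Type} [NormedAddCommGroup Z] (E : HilbertBimod C D Z) :
    PreHilbertBimod C D Z :=
  { E with }

lemma HilbertBimod.vnorm_toPre {Z : Type} [NormedAddCommGroup Z] (E : HilbertBimod C D Z) (z : Z) :
    E.toPre.vnorm z = ‖z‖ := by
  change Real.sqrt ‖E.rinner z z‖ = _
  rw [E.norm_rinner_self, Real.sqrt_sq (norm_nonneg _)]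

/-- If the span of a set of elements of `R ⊆ S`, stable under left multiplication by `R`, is dense
near `1`, then `1` is a finite sum of elements of that set. -/
lemma exists_fin_sum_eq_one {R S : Type} [CStarAlgebra R] [CStarAlgebra S] (ι : R →⋆ₐ[ℂ] S)
    (hι : ∀ r, ‖ι r‖ = ‖r‖) (P : Set S) (hP : ∀ p ∈ P, ∃ r, ι r = p)
    (hmul : ∀ r, ∀ p ∈ P, ι r * p ∈ P)
    (h1 : (1 : S) ∈ (Submodule.span ℂ P).topologicalClosure) :
    ∃ (k : ℕ) (f : Fin k → S), (∀ i, f i ∈ P) ∧ ∑ i, f i = 1 := by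
  obtain ⟨v, hv, hv1⟩ := Metric.mem_closure_iff.mp h1 1 one_pos
  have hsub : Submodule.span ℂ P ≤ LinearMap.range ι.toAlgHom.toLinearMap :=
    Submodule.span_le.mpr fun p hp => hP p hp
  obtain ⟨a, rfl⟩ : ∃ a, ι a = v := hsub hv
  have ha : IsUnit a := by
    have : ‖1 - a‖ < 1 := by rwa [← hι, map_sub, map_one, ← dist_eq_norm]
    simpa using isUnit_one_sub_of_norm_lt_one this
  obtain ⟨a', -, ha'⟩ := isUnit_iff_exists.mp ha
  obtain ⟨k, f, g, hfg⟩ := Submodule.mem_span_set'.mp hv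
  refine ⟨k, fun i => ι (f i • a') * g i, fun i => hmul _ _ (g i).2, ?_⟩
  calc ∑ i, ι (f i • a') * g i = ι a' * ∑ i, f i • (g i : S) := by
        rw [Finset.mul_sum]
        exact Finset.sum_congr rfl fun i _ => by rw [map_smul, smul_mul_assoc, mul_smul_comm]
    _ = 1 := by rw [hfg, ← map_mul, ha', map_one]

namespace HilbertBimod

variable {Z : Type} [NormedAddCommGroup Z]

lemma LFull.exists_isLFrame {E : HilbertBimod C D Z} (h : E.LFull) :
    ∃ (k : ℕ) (u v : Fin k → Z), E.toPre.IsLFrame u v := by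
  obtain ⟨k, f, hf, hs⟩ := exists_fin_sum_eq_one (StarAlgHom.id ℂ C) (fun _ => rfl)
    {c : C | ∃ x y : Z, c = E.linner x y} (fun p _ => ⟨p, rfl⟩)
    (by rintro r _ ⟨x, y, rfl⟩; exact ⟨E.lsmul r x, y, (E.linner_lsmul_left r x y).symm⟩)
    (by rw [show _ = _ from h]; trivial)
  choose u v huv using hf
  exact ⟨k, u, v, (Finset.sum_congr rfl fun i _ => (huv i).symm).trans hs⟩

lemma RFull.exists_isRFrame {E : HilbertBimod C D Z} (h : E.RFull) :
    ∃ (k : ℕ) (u v : Fin k → Z), E.toPre.IsRFrame u v := by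
  obtain ⟨k, f, hf, hs⟩ := exists_fin_sum_eq_one (StarAlgHom.id ℂ D) (fun _ => rfl)
    {d : D | ∃ x y : Z, d = E.rinner x y} (fun p _ => ⟨p, rfl⟩)
    (by
      rintro r _ ⟨x, y, rfl⟩
      refine ⟨E.rsmul x (star r), y, ?_⟩
      have := E.toPre.rinner_rsmul_left x y (star r)
      rw [star_star] at this
      exact this.symm)
    (by rw [show _ = _ from h]; trivial)
  choose u v huv using hf
  exact ⟨k, u, v, (Finset.sum_congr rfl fun i _ => (huv i).symm).trans hs⟩

lemma lFull_of_isLFrame {E : HilbertBimod C D Z} {k : ℕ} {u v : Fin k → Z}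
    (h : E.toPre.IsLFrame u v) : E.LFull := by
  have : Submodule.span ℂ {c : C | ∃ x y : Z, c = E.linner x y} = ⊤ := by
    refine Submodule.eq_top_iff'.mpr fun c => ?_
    rw [← mul_one c, ← h, Finset.mul_sum]
    refine Submodule.sum_mem _ fun i _ => Submodule.subset_span ⟨E.lsmul c (u i), v i, ?_⟩
    exact (E.linner_lsmul_left _ _ _).symm
  rw [LFull, this, eq_top_iff]
  exact Submodule.le_topologicalClosure _

lemma rFull_of_isRFrame {E : HilbertBimod C D Z} {k : ℕ} {u v : Fin k → Z}
    (h : E.toPre.IsRFrame u v) : E.RFull := by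
  have : Submodule.span ℂ {d : D | ∃ x y : Z, d = E.rinner x y} = ⊤ := by
    refine Submodule.eq_top_iff'.mpr fun d => ?_
    rw [← one_mul d, ← h, Finset.sum_mul]
    refine Submodule.sum_mem _ fun i _ => Submodule.subset_span ⟨u i, E.rsmul (v i) d, ?_⟩
    exact (E.rinner_rsmul_right _ _ _).symm
  rw [RFull, this, eq_top_iff]
  exact Submodule.le_topologicalClosure _

/-- The conjugate Hilbert bimodule, on the same underlying group. -/
def dual (E : HilbertBimod C D Z) : HilbertBimod D C Z :=
  { E.toPre.dual with
    norm_linner_self := E.norm_rinner_self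
    norm_rinner_self := E.norm_linner_self }

/-- A subgroup of a Hilbert bimodule which is a Hilbert bimodule over C*-subalgebras of the
coefficients. -/
def restrict (E : HilbertBimod C D Z) (ιA : A →⋆ₐ[ℂ] C) (hA : ∀ a, ‖ιA a‖ = ‖a‖)
    (ιB : B →⋆ₐ[ℂ] D) (hB : ∀ b, ‖ιB b‖ = ‖b‖) (W : AddSubgroup Z)
    (hl : ∀ a, ∀ x ∈ W, E.lsmul (ιA a) x ∈ W) (hr : ∀ b, ∀ x ∈ W, E.rsmul x (ιB b) ∈ W)
    (pA : C → A) (pB : D → B)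
    (hli : ∀ x ∈ W, ∀ y ∈ W, ιA (pA (E.linner x y)) = E.linner x y)
    (hri : ∀ x ∈ W, ∀ y ∈ W, ιB (pB (E.rinner x y)) = E.rinner x y) : HilbertBimod A B W :=
  have iA : Function.Injective ιA := (AddMonoidHomClass.isometry_of_norm ιA hA).injective
  have iB : Function.Injective ιB := (AddMonoidHomClass.isometry_of_norm ιB hB).injective
  have hli (x y : W) : ιA (pA (E.linner x y)) = E.linner x y := hli x x.2 y y.2
  have hri (x y : W) : ιB (pB (E.rinner x y)) = E.rinner x y := hri x x.2 y y.2
  { lsmul := fun a x => ⟨E.lsmul (ιA a) x, hl a x x.2⟩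
    rsmul := fun x b => ⟨E.rsmul x (ιB b), hr b x x.2⟩
    linner := fun x y => pA (E.linner x y)
    rinner := fun x y => pB (E.rinner x y)
    lsmul_add := fun _ _ _ => Subtype.ext (E.lsmul_add _ _ _)
    add_lsmul := fun _ _ _ => Subtype.ext (by simp [E.add_lsmul])
    mul_lsmul := fun _ _ _ => Subtype.ext (by simp [E.mul_lsmul])
    one_lsmul := fun _ => Subtype.ext (by simp [E.one_lsmul])
    rsmul_add := fun _ _ _ => Subtype.ext (E.rsmul_add _ _ _)
    add_rsmul := fun _ _ _ => Subtype.ext (by simp [E.add_rsmul])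
    rsmul_mul := fun _ _ _ => Subtype.ext (by simp [E.rsmul_mul])
    rsmul_one := fun _ => Subtype.ext (by simp [E.rsmul_one])
    lsmul_rsmul := fun _ _ _ => Subtype.ext (E.lsmul_rsmul _ _ _)
    linner_add_left := fun x y z => iA ((hli _ _).trans (by rw [map_add, hli, hli]; exact E.linner_add_left _ _ _))
    linner_add_right := fun x y z => iA ((hli _ _).trans (by rw [map_add, hli, hli]; exact E.linner_add_right _ _ _))
    linner_lsmul_left := fun a x y => iA ((hli ⟨_, hl a x x.2⟩ _).trans (by
      rw [map_mul, hli]; exact E.linner_lsmul_left _ _ _))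
    linner_star := fun _ _ => iA (by simp [hli, E.linner_star, map_star])
    rinner_add_left := fun x y z => iB ((hri _ _).trans (by rw [map_add, hri, hri]; exact E.rinner_add_left _ _ _))
    rinner_add_right := fun x y z => iB ((hri _ _).trans (by rw [map_add, hri, hri]; exact E.rinner_add_right _ _ _))
    rinner_rsmul_right := fun x y b => iB ((hri _ ⟨_, hr b y y.2⟩).trans (by
      rw [map_mul, hri]; exact E.rinner_rsmul_right _ _ _))
    rinner_star := fun _ _ => iB (by simp [hri, E.rinner_star, map_star])
    inner_assoc := fun _ _ _ => Subtype.ext (by simp [hri, hli, E.inner_assoc])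
    norm_linner_self := fun x => by rw [← hA, hli, E.norm_linner_self]; rfl
    norm_rinner_self := fun x => by rw [← hB, hri, E.norm_rinner_self]; rfl }

end HilbertBimod

namespace InvolBundleAlg

variable {E : HilbertBimod A A X} {J : Involution E} (K : InvolBundleAlg E J C)

/-- The decomposition `C ≅ A ⊕ X`. -/
def equiv : A × X ≃+ C :=
  AddEquiv.ofBijective
    (AddMonoidHom.mk' (fun p : A × X => K.ιA p.1 + K.ιX p.2) fun p q => by simp; abel)
    K.sum_bijective

/-- The component in `A`. -/
def prA : C →+ A := (AddMonoidHom.fst A X).comp K.equiv.symm.toAddMonoidHom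

/-- The component in `X`. -/
def prX : C →+ X := (AddMonoidHom.snd A X).comp K.equiv.symm.toAddMonoidHom

lemma prA_add_prX (c : C) : K.ιA (K.prA c) + K.ιX (K.prX c) = c := K.equiv.apply_symm_apply c

lemma equiv_symm_add (a : A) (x : X) : K.equiv.symm (K.ιA a + K.ιX x) = (a, x) :=
  K.equiv.symm_apply_apply (a, x)

@[simp] lemma prA_ιA (a : A) : K.prA (K.ιA a) = a := by
  have := congrArg Prod.fst (K.equiv_symm_add a 0)
  simp only [map_zero, add_zero] at this
  exact this

@[simp] lemma prX_ιA (a : A) : K.prX (K.ιA a) = 0 := by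
  have := congrArg Prod.snd (K.equiv_symm_add a 0)
  simp only [map_zero, add_zero] at this
  exact this

@[simp] lemma prA_ιX (x : X) : K.prA (K.ιX x) = 0 := by
  have := congrArg Prod.fst (K.equiv_symm_add 0 x)
  simp only [map_zero, zero_add] at this
  exact this

@[simp] lemma prX_ιX (x : X) : K.prX (K.ιX x) = x := by
  have := congrArg Prod.snd (K.equiv_symm_add 0 x)
  simp only [map_zero, zero_add] at this
  exact this

lemma induction {p : C → Prop} (hp : ∀ a x, p (K.ιA a + K.ιX x)) (c : C) : p c := by
  rw [← K.prA_add_prX c]; exact hp _ _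

/-- The grading automorphism `a + x ↦ a - x`. -/
def grade : C →⋆ₐ[ℂ] C where
  toFun c := K.ιA (K.prA c) - K.ιX (K.prX c)
  map_one' := by
    have h1 := K.prA_ιA 1
    have h2 := K.prX_ιA 1
    rw [map_one] at h1 h2
    simp [h1, h2]
  map_zero' := by simp
  map_add' c c' := by simp; abel
  map_mul' c c' := by
    induction c using K.induction with | hp a x
    induction c' using K.induction with | hp b y
    simp [mul_add, add_mul, mul_sub, sub_mul, K.mul_AX, K.mul_XA, K.mul_XX, ← map_mul]
    abel
  commutes' z := by rw [← AlgHomClass.commutes K.ιA z]; simp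
  map_star' c := by
    induction c using K.induction with | hp a x
    simp [← map_star, K.star_X]

@[simp] lemma grade_ιA (a : A) : K.grade (K.ιA a) = K.ιA a := by
  change K.ιA (K.prA _) - K.ιX (K.prX _) = _
  simp

@[simp] lemma grade_ιX (x : X) : K.grade (K.ιX x) = -K.ιX x := by
  change K.ιA (K.prA _) - K.ιX (K.prX _) = _
  simp

@[simp] lemma grade_grade (c : C) : K.grade (K.grade c) = c := by
  induction c using K.induction with | hp a x
  simp

lemma eq_ιA_of_grade {c : C} (h : K.grade c = c) : K.ιA (K.prA c) = c := by
  induction c using K.induction with | hp a x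
  have h3 : (2 : ℂ) • K.ιX x = 0 := by
    simp only [map_add, grade_ιA, grade_ιX, add_right_inj] at h
    rw [two_smul, ← sub_neg_eq_add, h, sub_self]
  rw [(smul_eq_zero.mp h3).resolve_left two_ne_zero]
  simp

lemma eq_ιX_of_grade {c : C} (h : K.grade c = -c) : K.ιX (K.prX c) = c := by
  induction c using K.induction with | hp a x
  have h3 : (2 : ℂ) • K.ιA a = 0 := by
    simp only [map_add, grade_ιA, grade_ιX, neg_add, add_left_inj] at h
    nth_rw 1 [two_smul, h, neg_add_cancel]
  rw [(smul_eq_zero.mp h3).resolve_left two_ne_zero]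
  simp

lemma norm_ιA_prA_le (c : C) : ‖K.prA c‖ ≤ ‖c‖ := by
  have h : (2 : ℂ) • K.ιA (K.prA c) = c + K.grade c := by
    induction c using K.induction with | hp a x
    simp [two_smul]
    abel
  have h2 := norm_add_le c (K.grade c)
  rw [← h, norm_smul, K.norm_A] at h2
  have h3 := NonUnitalStarAlgHom.norm_apply_le K.grade c
  norm_num at h2
  linarith

lemma mem_span_range {c : C} : c ∈ Submodule.span ℂ (Set.range K.ιA) ↔ ∃ a, K.ιA a = c := by
  have : Submodule.span ℂ (Set.range K.ιA) = LinearMap.range K.ιA.toAlgHom.toLinearMap :=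
    le_antisymm (Submodule.span_le.mpr fun _ h => h) fun _ h => Submodule.subset_span h
  rw [this]; rfl

lemma isometry_ιA : Isometry K.ιA := AddMonoidHomClass.isometry_of_norm K.ιA K.norm_A

lemma isometry_ιX : Isometry K.ιX := AddMonoidHomClass.isometry_of_norm K.ιX K.norm_X

include K in
lemma completeSpace : CompleteSpace X := by
  have hr : Set.range K.ιX = K.prA ⁻¹' {0} := by
    ext c
    refine ⟨?_, fun h => ⟨K.prX c, ?_⟩⟩
    · rintro ⟨x, rfl⟩; simp
    · have := K.prA_add_prX c
      rwa [show K.prA c = 0 from h, map_zero, zero_add] at this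
  have hc : Continuous K.prA := AddMonoidHomClass.continuous_of_bound K.prA 1 fun c => by
    simpa using K.norm_ιA_prA_le c
  refine (completeSpace_iff_isComplete_range K.isometry_ιX.isUniformInducing).mpr ?_
  rw [hr]
  exact (isClosed_singleton.preimage hc).isComplete

end InvolBundleAlg

/-- A subgroup of a `C`-`D`-bimodule which is a bimodule over the coefficient algebras `A` and `B`
of the inclusions `A ⊆ C` and `B ⊆ D`, and which contains frames for both inner products. -/
structure FramedSubgroup {EX : HilbertBimod A A X} {JX : Involution EX} {EY : HilbertBimod B B Y}
    {JY : Involution EY} (BX : InvolBundleAlg EX JX C) (BY : InvolBundleAlg EY JY D)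
    {Z : Type} [AddCommGroup Z] (H : PreHilbertBimod C D Z) where
  M : AddSubgroup Z
  lsmul_mem : ∀ a, ∀ x ∈ M, H.lsmul (BX.ιA a) x ∈ M
  rsmul_mem : ∀ b, ∀ x ∈ M, H.rsmul x (BY.ιA b) ∈ M
  linner_mem : ∀ x ∈ M, ∀ y ∈ M, ∃ a, BX.ιA a = H.linner x y
  rinner_mem : ∀ x ∈ M, ∀ y ∈ M, ∃ b, BY.ιA b = H.rinner x y
  k : ℕ
  m : Fin k → Z
  n : Fin k → Z
  m_mem : ∀ i, m i ∈ M
  n_mem : ∀ i, n i ∈ M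
  rframe : H.IsRFrame m n
  l : ℕ
  u : Fin l → Z
  v : Fin l → Z
  u_mem : ∀ i, u i ∈ M
  v_mem : ∀ i, v i ∈ M
  lframe : H.IsLFrame u v

namespace FramedSubgroup

variable {EX : HilbertBimod A A X} {JX : Involution EX} {EY : HilbertBimod B B Y}
    {JY : Involution EY} {BX : InvolBundleAlg EX JX C} {BY : InvolBundleAlg EY JY D}
    {Z : Type} [AddCommGroup Z] {H : PreHilbertBimod C D Z} (F : FramedSubgroup BX BY H)

lemma grade_linner {x y : Z} (hx : x ∈ F.M) (hy : y ∈ F.M) :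
    BX.grade (H.linner x y) = H.linner x y := by
  obtain ⟨a, ha⟩ := F.linner_mem x hx y hy
  rw [← ha, BX.grade_ιA]

/-- The extension of the grading of `C` to the bimodule which fixes the subgroup pointwise. -/
def sgn : Z →+ Z :=
  ∑ i, (H.lsmulRight (F.n i)).comp ((BX.grade : C →+ C).comp (H.linnerLeft (F.m i)))

lemma sgn_apply (e : Z) :
    F.sgn e = ∑ i, H.lsmul (BX.grade (H.linner e (F.m i))) (F.n i) := by
  simp only [sgn, AddMonoidHom.finsetSum_apply]
  rfl

lemma sgn_lsmul (c : C) (e : Z) : F.sgn (H.lsmul c e) = H.lsmul (BX.grade c) (F.sgn e) := by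
  simp only [sgn_apply, H.lsmul_sum, H.linner_lsmul_left, map_mul, H.mul_lsmul]

lemma sgn_of_mem {x : Z} (hx : x ∈ F.M) : F.sgn x = x := by
  rw [sgn_apply]
  conv_rhs => rw [F.rframe.expand x]
  exact Finset.sum_congr rfl fun i _ => by rw [F.grade_linner hx (F.m_mem i)]

lemma sgn_sgn (e : Z) : F.sgn (F.sgn e) = e := by
  conv_lhs => rw [F.sgn_apply e, map_sum]
  conv_rhs => rw [F.rframe.expand e]
  exact Finset.sum_congr rfl fun i _ => by
    rw [sgn_lsmul, BX.grade_grade, F.sgn_of_mem (F.n_mem i)]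

lemma eq_sum_of_sgn {e : Z} {ε : ℂ} (h : F.sgn e = H.lsmul (algebraMap ℂ C ε) e)
    (hε : ε * ε = 1) :
    e = ∑ i, H.lsmul ((1 / 2 : ℂ) • (H.linner e (F.m i) + ε • BX.grade (H.linner e (F.m i))))
      (F.n i) := by
  have h2 : e = H.lsmul (algebraMap ℂ C (1 / 2)) (e + H.lsmul (algebraMap ℂ C ε) (F.sgn e)) := by
    rw [h, ← H.mul_lsmul, ← map_mul, hε, map_one, H.one_lsmul]
    conv_rhs => rw [← H.one_lsmul e, ← H.add_lsmul, ← H.mul_lsmul, ← map_one (algebraMap ℂ C),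
      ← map_add, ← map_mul]
    norm_num [H.one_lsmul]
  conv_lhs => rw [h2, F.sgn_apply e]
  conv_lhs =>
    enter [3, 1]
    rw [F.rframe.expand e]
  rw [H.lsmul_sum, ← Finset.sum_add_distrib, H.lsmul_sum]
  exact Finset.sum_congr rfl fun i _ => by
    rw [← H.mul_lsmul, ← H.add_lsmul, ← H.mul_lsmul, Algebra.smul_def, Algebra.smul_def]

lemma mem_of_sgn {e : Z} (h : F.sgn e = e) : e ∈ F.M := by
  rw [F.eq_sum_of_sgn (e := e) (ε := 1) (by rw [map_one, H.one_lsmul, h]) (by norm_num)]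
  refine sum_mem fun i _ => ?_
  rw [one_smul, ← BX.eq_ιA_of_grade (c := _ • _)
    (by rw [map_smul, map_add, BX.grade_grade, add_comm])]
  exact F.lsmul_mem _ _ (F.n_mem i)

/-- The vectors negated by the extended grading are spanned by `ιX(X) M`. -/
lemma eq_sum_of_sgn_eq_neg {e : Z} (h : F.sgn e = -e) :
    ∃ x : Fin F.k → X, e = ∑ i, H.lsmul (BX.ιX (x i)) (F.n i) := by
  have := F.eq_sum_of_sgn (e := e) (ε := -1)
    (by rw [map_neg, map_one, H.neg_lsmul, H.one_lsmul, h]) (by norm_num)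
  refine ⟨fun i => BX.prX ((1 / 2 : ℂ) •
    (H.linner e (F.m i) + (-1 : ℂ) • BX.grade (H.linner e (F.m i)))),
    this.trans (Finset.sum_congr rfl fun i _ => ?_)⟩
  rw [BX.eq_ιX_of_grade]
  simp only [map_smul, map_add, map_neg, BX.grade_grade, ← smul_neg, neg_add, neg_smul, one_smul, neg_neg]
  rw [add_comm]

lemma linner_sgn_left (e : Z) {x : Z} (hx : x ∈ F.M) :
    H.linner (F.sgn e) x = BX.grade (H.linner e x) := by
  conv_rhs => rw [F.rframe.expand e, H.linner_sum_left, map_sum]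
  rw [sgn_apply, H.linner_sum_left]
  exact Finset.sum_congr rfl fun i _ => by
    rw [H.linner_lsmul_left, H.linner_lsmul_left, map_mul, F.grade_linner (F.n_mem i) hx]

lemma linner_sgn_right (e : Z) {x : Z} (hx : x ∈ F.M) :
    H.linner x (F.sgn e) = BX.grade (H.linner x e) := by
  rw [← H.linner_star, F.linner_sgn_left e hx, ← map_star, H.linner_star]

/-- The automorphism of `D` induced by the extended grading of the bimodule. -/
def inducedAut : D →+ D :=
  ∑ i, (H.rinnerRight (F.m i)).comp (F.sgn.comp (H.rsmulLeft (F.n i)))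

lemma inducedAut_apply (d : D) :
    F.inducedAut d = ∑ i, H.rinner (F.m i) (F.sgn (H.rsmul (F.n i) d)) := by
  simp only [inducedAut, AddMonoidHom.finsetSum_apply]
  rfl

lemma rsmul_inducedAut {x : Z} (hx : x ∈ F.M) (d : D) :
    H.rsmul x (F.inducedAut d) = F.sgn (H.rsmul x d) := by
  rw [inducedAut_apply, H.rsmul_sum]
  conv_rhs => rw [F.rframe.expand x, H.sum_rsmul, map_sum]
  exact Finset.sum_congr rfl fun i _ => by
    rw [← H.inner_assoc, H.lsmul_rsmul, sgn_lsmul, F.grade_linner hx (F.m_mem i)]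

lemma sgn_rsmul (e : Z) (d : D) : F.sgn (H.rsmul e d) = H.rsmul (F.sgn e) (F.inducedAut d) := by
  conv_lhs => rw [F.rframe.expand e, H.sum_rsmul, map_sum]
  rw [F.sgn_apply e, H.sum_rsmul]
  exact Finset.sum_congr rfl fun i _ => by
    rw [H.lsmul_rsmul, H.lsmul_rsmul, sgn_lsmul, F.rsmul_inducedAut (F.n_mem i)]

lemma inducedAut_mul (d d' : D) :
    F.inducedAut (d * d') = F.inducedAut d * F.inducedAut d' :=
  F.rframe.faithful fun i => by
    rw [F.rsmul_inducedAut (F.n_mem i), H.rsmul_mul, sgn_rsmul, H.rsmul_mul,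
      F.rsmul_inducedAut (F.n_mem i)]

lemma inducedAut_inducedAut (d : D) : F.inducedAut (F.inducedAut d) = d :=
  F.rframe.faithful fun i => by
    rw [F.rsmul_inducedAut (F.n_mem i), F.rsmul_inducedAut (F.n_mem i), sgn_sgn]

@[simp] lemma inducedAut_ιA (b : B) : F.inducedAut (BY.ιA b) = BY.ιA b :=
  F.rframe.faithful fun i => by
    rw [F.rsmul_inducedAut (F.n_mem i), F.sgn_of_mem (F.rsmul_mem _ _ (F.n_mem i))]

lemma exists_ιA_of_inducedAut {d : D} (h : F.inducedAut d = d) : ∃ b, BY.ιA b = d := by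
  have : ∀ i, ∃ b, BY.ιA b = H.rinner (F.m i) (H.rsmul (F.n i) d) := fun i =>
    F.rinner_mem _ (F.m_mem i) _ (F.mem_of_sgn (by rw [← F.rsmul_inducedAut (F.n_mem i), h]))
  choose b hb using this
  refine ⟨∑ i, b i, ?_⟩
  rw [map_sum, ← one_mul d, ← F.rframe, Finset.sum_mul]
  exact Finset.sum_congr rfl fun i _ => by rw [hb, H.rinner_rsmul_right]

lemma exists_lsmul_eq_rsmul {w : D} (hw : ∀ b, BY.ιA b * w = w * BY.ιA b) :
    ∃ c : C, (∀ x ∈ F.M, H.lsmul c x = H.rsmul x w) ∧ ∀ a, BX.ιA a * c = c * BX.ιA a := by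
  have key : ∀ x ∈ F.M, H.lsmul (∑ i, H.linner (H.rsmul (F.u i) w) (F.v i)) x = H.rsmul x w := by
    intro x hx
    conv_rhs => rw [F.lframe.expand x, H.sum_rsmul]
    rw [H.sum_lsmul]
    refine Finset.sum_congr rfl fun i _ => ?_
    obtain ⟨b, hb⟩ := F.rinner_mem _ (F.v_mem i) x hx
    rw [H.inner_assoc, ← hb, ← H.rsmul_mul, ← H.rsmul_mul, hw]
  refine ⟨_, key, fun a => F.lframe.faithful fun i => ?_⟩
  rw [H.mul_lsmul, H.mul_lsmul, key _ (F.u_mem i), key _ (F.lsmul_mem a _ (F.u_mem i)),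
    H.lsmul_rsmul]

theorem inducedAut_ιX (hY : EY.LFull)
    (hc : ∀ c : C, (∀ a : A, BX.ιA a * c = c * BX.ιA a) → ∃ z : ℂ, c = algebraMap ℂ C z) (y : Y) :
    F.inducedAut (BY.ιX y) = -BY.ιX y := by
  obtain ⟨r, p, q, hpq⟩ := hY.exists_isLFrame
  set β := F.inducedAut
  have h1 : ∑ i, BY.ιX (p i) * BY.ιX (JY.invol (q i)) = 1 := by
    simp only [BY.mul_XX, JY.invol_invol, ← map_sum]
    rw [show ∑ i, EY.linner (p i) (q i) = 1 from hpq, map_one]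
  have hyy : ∀ y y' : Y, β (BY.ιX y) * β (BY.ιX y') = BY.ιX y * BY.ιX y' := fun y y' => by
    rw [← F.inducedAut_mul, BY.mul_XX, F.inducedAut_ιA]
  set w : D := ∑ i, β (BY.ιX (p i)) * BY.ιX (JY.invol (q i)) with hw
  have hw1 : ∀ y, β (BY.ιX y) * w = BY.ιX y := fun y => by
    rw [hw, Finset.mul_sum]
    simp only [← mul_assoc, hyy]
    simp only [mul_assoc, ← Finset.mul_sum, h1, mul_one]
  have hw2 : ∀ y, BY.ιX y * β w = β (BY.ιX y) := fun y => by
    conv_rhs => rw [← hw1 y, F.inducedAut_mul, F.inducedAut_inducedAut]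
  have hwb : ∀ b, BY.ιA b * w = w * BY.ιA b := fun b => by
    have e1 : ∀ i j, β (BY.ιX (p j)) * BY.ιX (JY.invol (q j)) * BY.ιA b * BY.ιX (p i)
        = β (BY.ιX (p j) * BY.ιX (JY.invol (q j)) * BY.ιA b * BY.ιX (p i)) := fun i j => by
      rw [mul_assoc, mul_assoc, BY.mul_AX, BY.mul_XX, mul_assoc, mul_assoc, BY.mul_AX, BY.mul_XX,
        F.inducedAut_mul, F.inducedAut_ιA]
    have e2 : ∀ i, w * BY.ιA b * BY.ιX (p i) = BY.ιA b * β (BY.ιX (p i)) := fun i => by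
      rw [hw, Finset.sum_mul, Finset.sum_mul]
      simp only [e1]
      rw [← map_sum, ← Finset.sum_mul, ← Finset.sum_mul, h1, one_mul, F.inducedAut_mul,
        F.inducedAut_ιA]
    calc BY.ιA b * w = ∑ i, w * BY.ιA b * BY.ιX (p i) * BY.ιX (JY.invol (q i)) := by
          simp only [e2]
          simp only [hw, Finset.mul_sum, mul_assoc]
      _ = w * BY.ιA b := by simp only [mul_assoc, ← Finset.mul_sum, h1, mul_one]
  obtain ⟨c, hcw, hca⟩ := F.exists_lsmul_eq_rsmul hwb
  obtain ⟨z, rfl⟩ := hc c hca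
  have hβw : β w = w := F.rframe.faithful fun i => by
    rw [F.rsmul_inducedAut (F.n_mem i), ← hcw _ (F.n_mem i), sgn_lsmul, F.sgn_of_mem (F.n_mem i),
      AlgHomClass.commutes]
  rw [hβw] at hw2
  have hw3 : w * w = 1 := by
    rw [← one_mul (w * w), ← h1, Finset.sum_mul]
    exact Finset.sum_congr rfl fun i _ => by
      rw [mul_assoc, ← mul_assoc _ w, hw2, hw1]
  have hz1 : ∀ x ∈ F.M, H.lsmul (algebraMap ℂ C (z * z - 1)) x = 0 := fun x hx => by
    rw [map_sub, map_mul, map_one, H.sub_lsmul, H.mul_lsmul, hcw x hx, ← H.lsmul_rsmul, hcw x hx,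
      ← H.rsmul_mul, hw3, H.rsmul_one, H.one_lsmul, sub_self]
  by_cases hz : z * z - 1 = 0
  · have : (z - 1) * (z + 1) = 0 := by linear_combination hz
    rcases mul_eq_zero.mp this with h | h
    · obtain rfl : z = 1 := by linear_combination h
      have hw4 : w = 1 := F.rframe.faithful fun i => by
        rw [← hcw _ (F.n_mem i), map_one, H.one_lsmul, H.rsmul_one]
      obtain ⟨b, hb⟩ := F.exists_ιA_of_inducedAut (d := BY.ιX y)
        (by rw [← hw2, hw4, mul_one])
      have : y = 0 := by rw [← BY.prX_ιX y, ← hb, BY.prX_ιA]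
      simp [this]
    · obtain rfl : z = -1 := by linear_combination h
      have hw4 : w = -1 := F.rframe.faithful fun i => by
        rw [← hcw _ (F.n_mem i), map_neg, map_one, H.neg_lsmul, H.rsmul_neg, H.one_lsmul,
          H.rsmul_one]
      rw [← hw2, hw4, mul_neg, mul_one]
  · refine F.rframe.faithful fun i => ?_
    have : F.n i = 0 := by
      rw [← H.one_lsmul (F.n i), ← map_one (algebraMap ℂ C), ← inv_mul_cancel₀ hz, map_mul,
        H.mul_lsmul, hz1 _ (F.n_mem i), H.lsmul_zero]
    rw [this, H.zero_rsmul, H.zero_rsmul]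

theorem inducedAut_eq_grade (hY : EY.LFull)
    (hc : ∀ c : C, (∀ a : A, BX.ιA a * c = c * BX.ιA a) → ∃ z : ℂ, c = algebraMap ℂ C z) (d : D) :
    F.inducedAut d = BY.grade d := by
  induction d using BY.induction with | hp b y
  simp [F.inducedAut_ιX hY hc]

lemma grade_rinner (hg : ∀ d, F.inducedAut d = BY.grade d) (e f : Z) :
    BY.grade (H.rinner e f) = H.rinner (F.sgn e) (F.sgn f) :=
  F.rframe.faithful fun i => by
    rw [← hg, F.rsmul_inducedAut (F.n_mem i), ← H.inner_assoc, sgn_lsmul, ← H.inner_assoc,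
      F.linner_sgn_right _ (F.n_mem i)]

lemma grade_linner_eq (hg : ∀ d, F.inducedAut d = BY.grade d) (e f : Z) :
    BX.grade (H.linner e f) = H.linner (F.sgn e) (F.sgn f) :=
  F.lframe.faithful fun i => by
    conv_lhs => rw [← F.sgn_of_mem (F.u_mem i)]
    rw [← sgn_lsmul, H.inner_assoc, sgn_rsmul, hg, F.grade_rinner hg, H.inner_assoc,
      F.sgn_of_mem (F.u_mem i)]

end FramedSubgroup

namespace InvolBundleAlg

variable {E : HilbertBimod A A X} {J : Involution E} (K : InvolBundleAlg E J C)

lemma ιA_linner (x y : X) : K.ιA (E.linner x y) = K.ιX x * star (K.ιX y) := by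
  rw [K.star_X, K.mul_XX, J.invol_invol]

lemma ιA_rinner (x y : X) : K.ιA (E.rinner x y) = star (K.ιX x) * K.ιX y := by
  rw [← J.invol_invol x, ← J.linner_invol, ← K.mul_XX, ← K.star_X, J.invol_invol]

lemma ιA_injective : Function.Injective K.ιA := K.isometry_ιA.injective

lemma ιX_injective : Function.Injective K.ιX := K.isometry_ιX.injective

@[simp] lemma prA_one : K.prA 1 = 1 := by
  rw [← map_one K.ιA, K.prA_ιA]

end InvolBundleAlg

lemma PreHilbertBimod.IsRFrame.rinner_lsmul_left {Z : Type} [AddCommGroup Z]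
    {H : PreHilbertBimod C D Z} {k : ℕ} {u v : Fin k → Z} (h : H.IsRFrame u v) (c : C) (x y : Z) :
    H.rinner (H.lsmul c x) y = H.rinner x (H.lsmul (star c) y) :=
  h.faithful fun i => by
    rw [← H.inner_assoc, ← H.inner_assoc, H.linner_lsmul_right, H.mul_lsmul]

namespace FramedSubgroup

variable {EX : HilbertBimod A A X} {JX : Involution EX} {EY : HilbertBimod B B Y}
    {JY : Involution EY} {BX : InvolBundleAlg EX JX C} {BY : InvolBundleAlg EY JY D}
    {Z : Type} [NormedAddCommGroup Z] {E : HilbertBimod C D Z} (F : FramedSubgroup BX BY E.toPre)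

/-- The framed subgroup as a Hilbert `A`-`B`-bimodule. -/
def even : HilbertBimod A B F.M :=
  E.restrict BX.ιA BX.norm_A BY.ιA BY.norm_A F.M F.lsmul_mem F.rsmul_mem BX.prA BY.prA
    (fun x hx y hy => by
      obtain ⟨a, ha⟩ := F.linner_mem x hx y hy
      change BX.ιA a = E.linner x y at ha
      rw [← ha, BX.prA_ιA])
    (fun x hx y hy => by
      obtain ⟨a, ha⟩ := F.rinner_mem x hx y hy
      change BY.ιA a = E.rinner x y at ha
      rw [← ha, BY.prA_ιA])

lemma even_lFull : F.even.LFull :=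
  HilbertBimod.lFull_of_isLFrame (u := fun i => ⟨F.u i, F.u_mem i⟩)
    (v := fun i => ⟨F.v i, F.v_mem i⟩) (by
      have := congrArg BX.prA F.lframe
      rwa [map_sum, BX.prA_one] at this)

lemma even_rFull : F.even.RFull :=
  HilbertBimod.rFull_of_isRFrame (u := fun i => ⟨F.m i, F.m_mem i⟩)
    (v := fun i => ⟨F.n i, F.n_mem i⟩) (by
      have := congrArg BY.prA F.rframe
      rwa [map_sum, BY.prA_one] at this)

/-- The vectors negated by the extended grading. -/
def oddPart : AddSubgroup Z where
  carrier := {e | F.sgn e = -e}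
  zero_mem' := by simp
  add_mem' {x y} hx hy := by
    rw [Set.mem_ofPred_eq] at *
    rw [map_add, hx, hy, neg_add]
  neg_mem' {x} hx := by
    rw [Set.mem_ofPred_eq] at *
    rw [map_neg, hx]

lemma mem_oddPart {e : Z} : e ∈ F.oddPart ↔ F.sgn e = -e := Iff.rfl

lemma lsmul_mem_oddPart (x : X) {m : Z} (hm : m ∈ F.M) :
    E.toPre.lsmul (BX.ιX x) m ∈ F.oddPart := by
  rw [mem_oddPart, sgn_lsmul, F.sgn_of_mem hm, BX.grade_ιX, PreHilbertBimod.neg_lsmul]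

/-- The vectors negated by the extended grading, as a Hilbert `A`-`B`-bimodule. -/
def odd (hg : ∀ d, F.inducedAut d = BY.grade d) : HilbertBimod A B F.oddPart :=
  E.restrict BX.ιA BX.norm_A BY.ιA BY.norm_A F.oddPart
    (fun a x hx => by
      rw [mem_oddPart] at *
      exact (F.sgn_lsmul _ _).trans (by rw [hx, BX.grade_ιA]; exact E.toPre.lsmul_neg _ _))
    (fun b x hx => by
      rw [mem_oddPart] at *
      exact (F.sgn_rsmul _ _).trans (by rw [hx, F.inducedAut_ιA]; exact E.toPre.neg_rsmul _ _))
    BX.prA BY.prA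
    (fun x hx y hy => BX.eq_ιA_of_grade ((F.grade_linner_eq hg x y).trans (by
      rw [F.mem_oddPart.mp hx, F.mem_oddPart.mp hy, PreHilbertBimod.linner_neg_left,
        PreHilbertBimod.linner_neg_right, neg_neg]; rfl)))
    (fun x hx y hy => BY.eq_ιA_of_grade ((F.grade_rinner hg x y).trans (by
      rw [F.mem_oddPart.mp hx, F.mem_oddPart.mp hy, PreHilbertBimod.rinner_neg_left,
        PreHilbertBimod.rinner_neg_right, neg_neg]; rfl)))

lemma ιA_even_linner (x y : F.M) : BX.ιA (F.even.linner x y) = E.toPre.linner x y := by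
  obtain ⟨a, ha⟩ := F.linner_mem x x.2 y y.2
  change BX.ιA (BX.prA (E.toPre.linner x y)) = _
  rw [← ha, BX.prA_ιA]

lemma ιA_even_rinner (x y : F.M) : BY.ιA (F.even.rinner x y) = E.toPre.rinner x y := by
  obtain ⟨a, ha⟩ := F.rinner_mem x x.2 y y.2
  change BY.ιA (BY.prA (E.toPre.rinner x y)) = _
  rw [← ha, BY.prA_ιA]

lemma coe_even_lsmul (a : A) (x : F.M) :
    (F.even.lsmul a x : Z) = E.toPre.lsmul (BX.ιA a) x := rfl

lemma coe_even_rsmul (b : B) (x : F.M) :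
    (F.even.rsmul x b : Z) = E.toPre.rsmul x (BY.ιA b) := rfl

section

variable (hg : ∀ d, F.inducedAut d = BY.grade d)

lemma ιA_odd_linner (x y : F.oddPart) : BX.ιA ((F.odd hg).linner x y) = E.toPre.linner x y :=
  BX.eq_ιA_of_grade ((F.grade_linner_eq hg x y).trans (by
      rw [F.mem_oddPart.mp x.2, F.mem_oddPart.mp y.2, PreHilbertBimod.linner_neg_left,
        PreHilbertBimod.linner_neg_right, neg_neg]; rfl))

lemma ιA_odd_rinner (x y : F.oddPart) : BY.ιA ((F.odd hg).rinner x y) = E.toPre.rinner x y :=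
  BY.eq_ιA_of_grade ((F.grade_rinner hg x y).trans (by
      rw [F.mem_oddPart.mp x.2, F.mem_oddPart.mp y.2, PreHilbertBimod.rinner_neg_left,
        PreHilbertBimod.rinner_neg_right, neg_neg]; rfl))

lemma coe_odd_lsmul (a : A) (x : F.oddPart) :
    ((F.odd hg).lsmul a x : Z) = E.toPre.lsmul (BX.ιA a) x := rfl


include hg in
lemma ιX_prX_rinner (e : F.oddPart) (m : F.M) :
    BY.ιX (BY.prX (E.toPre.rinner e m)) = E.toPre.rinner e m :=
  BY.eq_ιX_of_grade (by
    rw [F.grade_rinner hg, F.mem_oddPart.mp e.2, F.sgn_of_mem m.2,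
      PreHilbertBimod.rinner_neg_left])

/-- The odd part is the tensor product of the conjugate of the even part with `X`. -/
def oddTensor : TensorData F.even.dual EX (F.odd hg).dual where
  tmul m x := ⟨E.toPre.lsmul (BX.ιX (JX.invol x)) m, F.lsmul_mem_oddPart _ m.2⟩
  tmul_add_left m m' x := Subtype.ext (E.lsmul_add _ _ _)
  tmul_add_right m x x' := Subtype.ext (by
    change E.toPre.lsmul (BX.ιX (JX.invol (x + x'))) m = E.toPre.lsmul _ m + E.toPre.lsmul _ m
    rw [JX.invol_add, map_add, PreHilbertBimod.add_lsmul])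
  tmul_balanced m a x := Subtype.ext (by
    change E.toPre.lsmul _ (E.toPre.lsmul (BX.ιA (star a)) m) = E.toPre.lsmul _ _
    rw [← PreHilbertBimod.mul_lsmul, JX.invol_lsmul, BX.mul_XA])
  lsmul_tmul b m x := Subtype.ext (E.lsmul_rsmul _ _ _)
  rsmul_tmul m x a := Subtype.ext (by
    change E.toPre.lsmul (BX.ιA (star a)) (E.toPre.lsmul _ m) = E.toPre.lsmul _ _
    rw [← PreHilbertBimod.mul_lsmul, JX.invol_rsmul, BX.mul_AX])
  linner_tmul m m' x x' := BY.ιA_injective (by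
    change BY.ιA ((F.odd hg).rinner _ _) = BY.ιA (F.even.rinner (F.even.lsmul _ _) _)
    rw [ιA_odd_rinner, ιA_even_rinner, coe_even_lsmul]
    simp only
    rw [F.rframe.rinner_lsmul_left, F.rframe.rinner_lsmul_left, map_star, star_star,
      BX.ιA_linner, ← PreHilbertBimod.mul_lsmul, BX.star_X, BX.star_X, JX.invol_invol])
  rinner_tmul m m' x x' := BX.ιA_injective (by
    change BX.ιA ((F.odd hg).linner _ _) = BX.ιA (EX.rinner _ (EX.lsmul (F.even.linner _ _) _))
    rw [ιA_odd_linner, BX.ιA_rinner, ← BX.mul_AX, ιA_even_linner]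
    simp only
    rw [PreHilbertBimod.linner_lsmul_left, PreHilbertBimod.linner_lsmul_right, BX.star_X,
      BX.star_X, JX.invol_invol])
  tmul_dense := by
    refine (dense_univ).mono fun e _ => ?_
    obtain ⟨x, hx⟩ := F.eq_sum_of_sgn_eq_neg (F.mem_oddPart.mp e.2)
    have : e = ∑ i, ⟨E.toPre.lsmul (BX.ιX (x i)) (F.n i),
        F.lsmul_mem_oddPart _ (F.n_mem i)⟩ := Subtype.ext (by
      rw [hx, AddSubgroup.val_finsetSum])
    rw [this]
    refine sum_mem fun i _ => AddSubgroup.subset_closure ⟨⟨F.n i, F.n_mem i⟩, JX.invol (x i), ?_⟩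
    simp only [JX.invol_invol]

/-- `Y` is the tensor product of the conjugate of the odd part with the even part. -/
def coeffTensor : TensorData (F.odd hg).dual F.even EY where
  tmul e m := BY.prX (E.toPre.rinner e m)
  tmul_add_left e e' m := by
    rw [← map_add, ← PreHilbertBimod.rinner_add_left]; rfl
  tmul_add_right e m m' := by
    rw [← map_add, ← PreHilbertBimod.rinner_add_right]; rfl
  tmul_balanced e a m := BY.ιX_injective (by
    rw [ιX_prX_rinner F hg, ιX_prX_rinner F hg, coe_even_lsmul]
    change E.toPre.rinner (E.toPre.lsmul (BX.ιA (star a)) e) m = _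
    rw [F.rframe.rinner_lsmul_left, map_star, star_star])
  lsmul_tmul b e m := BY.ιX_injective (by
    rw [← BY.mul_AX, ιX_prX_rinner F hg, ιX_prX_rinner F hg]
    change _ = E.toPre.rinner (E.toPre.rsmul e (BY.ιA (star b))) m
    rw [PreHilbertBimod.rinner_rsmul_left, map_star, star_star])
  rsmul_tmul e m b := BY.ιX_injective (by
    rw [← BY.mul_XA, ιX_prX_rinner F hg, ιX_prX_rinner F hg, coe_even_rsmul,
      PreHilbertBimod.rinner_rsmul_right])
  linner_tmul e e' m m' := BY.ιA_injective (by
    change _ = BY.ιA ((F.odd hg).rinner ((F.odd hg).lsmul (star (F.even.linner m m')) e) e')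
    rw [BY.ιA_linner, ιX_prX_rinner F hg, ιX_prX_rinner F hg, ιA_odd_rinner, coe_odd_lsmul,
      F.even.linner_star, ιA_even_linner, PreHilbertBimod.inner_assoc,
      PreHilbertBimod.rinner_rsmul_left, PreHilbertBimod.rinner_star, PreHilbertBimod.rinner_star])
  rinner_tmul e e' m m' := BY.ιA_injective (by
    change _ = BY.ιA (F.even.rinner m (F.even.lsmul ((F.odd hg).linner e e') m'))
    rw [BY.ιA_rinner, ιX_prX_rinner F hg, ιX_prX_rinner F hg, ιA_even_rinner, coe_even_lsmul,
      ιA_odd_linner, PreHilbertBimod.inner_assoc,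
      PreHilbertBimod.rinner_rsmul_right, PreHilbertBimod.rinner_star])
  tmul_dense := by
    refine (dense_univ).mono fun y _ => ?_
    have h1 : y = ∑ i, BY.prX (E.toPre.rinner (E.toPre.rsmul (F.n i) (star (BY.ιX y))) (F.m i)) := by
      rw [← map_sum]
      simp only [PreHilbertBimod.rinner_rsmul_left, star_star]
      rw [← Finset.mul_sum, show ∑ i, E.toPre.rinner (F.n i) (F.m i) = 1 from F.rframe.symm, mul_one,
        BY.prX_ιX]
    rw [h1]
    refine sum_mem fun i _ => AddSubgroup.subset_closure ⟨⟨_, ?_⟩, ⟨F.m i, F.m_mem i⟩, rfl⟩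
    rw [mem_oddPart, sgn_rsmul, hg, F.sgn_of_mem (F.n_mem i), BY.star_X, BY.grade_ιX,
      PreHilbertBimod.rsmul_neg]

include hg in
theorem nonempty_moduleSideZ2 [CompleteSpace Z] (hM : IsClosed (F.M : Set Z)) :
    Nonempty (ModuleSideZ2 EX JX EY JY) :=
  have : CompleteSpace F.M := hM.completeSpace_coe
  ⟨{ M := F.M
     EM := F.even
     lFull := F.even_lFull
     rFull := F.even_rFull
     M' := F.M
     EM' := F.even.dual
     DD :=
      { conj := id
        conj_add := fun _ _ => rfl
        conj_bijective := Function.bijective_id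
        lsmul_conj := fun _ _ => rfl
        rsmul_conj := fun _ _ => rfl
        linner_conj := fun _ _ => rfl
        rinner_conj := fun _ _ => rfl
        norm_conj := fun _ => rfl }
     T₁ := F.oddPart
     G₁ := (F.odd hg).dual
     TD₁ := F.oddTensor hg
     T := Y
     GT := EY
     TD := F.coeffTensor hg
     JT := JY
     hJT := fun m n x => BY.ιX_injective (by
      rw [← BY.star_X]
      change star (BY.ιX (BY.prX (E.toPre.rinner ((F.oddTensor hg).tmul m x) n)))
        = BY.ιX (BY.prX (E.toPre.rinner ((F.oddTensor hg).tmul n (JX.invol x)) m))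
      rw [ιX_prX_rinner F hg, ιX_prX_rinner F hg, PreHilbertBimod.rinner_star]
      simp only [oddTensor, JX.invol_invol]
      rw [F.rframe.rinner_lsmul_left, BX.star_X])
     Φ := id
     hΦ :=
      { map_add := fun _ _ => rfl
        bijective := Function.bijective_id
        map_lsmul := fun _ _ => rfl
        map_rsmul := fun _ _ => rfl
        map_linner := fun _ _ => rfl
        map_rinner := fun _ _ => rfl }
     hΦJ := fun _ => rfl }⟩

end

end FramedSubgroup

theorem MoritaIncl.exists_framedSubgroup {EX : HilbertBimod A A X} {JX : Involution EX}
    {EY : HilbertBimod B B Y} {JY : Involution EY} (BX : InvolBundleAlg EX JX C)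
    (BY : InvolBundleAlg EY JY D)
    (W : MoritaIncl C D (Submodule.span ℂ (Set.range BX.ιA)) (Submodule.span ℂ (Set.range BY.ιA))) :
    letI := W.instN
    ∃ F : FramedSubgroup BX BY W.E.toPre, F.M = W.X₀ := by
  let := W.instN
  obtain ⟨l, f, hf, hf1⟩ := exists_fin_sum_eq_one BX.ιA BX.norm_A
    {c : C | ∃ x ∈ W.X₀, ∃ y ∈ W.X₀, c = W.E.linner x y}
    (by rintro _ ⟨x, hx, y, hy, rfl⟩; exact BX.mem_span_range.mp (W.linner_mem hx hy))
    (by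
      rintro a _ ⟨x, hx, y, hy, rfl⟩
      exact ⟨W.E.lsmul (BX.ιA a) x, W.lsmul_mem (BX.mem_span_range.mpr ⟨a, rfl⟩) hx, y, hy,
        (W.E.linner_lsmul_left _ x y).symm⟩)
    (by rw [W.linner_full]; exact BX.mem_span_range.mpr ⟨1, map_one _⟩)
  obtain ⟨k, g, hg, hg1⟩ := exists_fin_sum_eq_one BY.ιA BY.norm_A
    {d : D | ∃ x ∈ W.X₀, ∃ y ∈ W.X₀, d = W.E.rinner x y}
    (by rintro _ ⟨x, hx, y, hy, rfl⟩; exact BY.mem_span_range.mp (W.rinner_mem hx hy))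
    (by
      rintro b _ ⟨x, hx, y, hy, rfl⟩
      refine ⟨W.E.rsmul x (BY.ιA (star b)),
        W.rsmul_mem hx (BY.mem_span_range.mpr ⟨_, rfl⟩), y, hy, ?_⟩
      have := W.E.toPre.rinner_rsmul_left x y (BY.ιA (star b))
      rw [← map_star, star_star] at this
      exact this.symm)
    (by rw [W.rinner_full]; exact BY.mem_span_range.mpr ⟨1, map_one _⟩)
  choose u hu v hv huv using hf
  choose m hm n hn hmn using hg
  exact ⟨{
    M := W.X₀
    lsmul_mem := fun a x hx => W.lsmul_mem (BX.mem_span_range.mpr ⟨a, rfl⟩) hx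
    rsmul_mem := fun b x hx => W.rsmul_mem hx (BY.mem_span_range.mpr ⟨b, rfl⟩)
    linner_mem := fun x hx y hy => BX.mem_span_range.mp (W.linner_mem hx hy)
    rinner_mem := fun x hx y hy => BY.mem_span_range.mp (W.rinner_mem hx hy)
    k := k
    m := m
    n := n
    m_mem := hm
    n_mem := hn
    rframe := (Finset.sum_congr rfl fun i _ => (hmn i).symm).trans hg1
    l := l
    u := u
    v := v
    u_mem := hu
    v_mem := hv
    lframe := (Finset.sum_congr rfl fun i _ => (huv i).symm).trans hf1 }, rfl⟩

theorem MoritaIncl.nonempty_moduleSideZ2 {EX : HilbertBimod A A X} {JX : Involution EX}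
    {EY : HilbertBimod B B Y} {JY : Involution EY} (BX : InvolBundleAlg EX JX C)
    (BY : InvolBundleAlg EY JY D) (hY : EY.LFull)
    (hc : ∀ c : C, (∀ a : A, BX.ιA a * c = c * BX.ιA a) → ∃ z : ℂ, c = algebraMap ℂ C z)
    (W : MoritaIncl C D (Submodule.span ℂ (Set.range BX.ιA)) (Submodule.span ℂ (Set.range BY.ιA))) :
    Nonempty (ModuleSideZ2 EX JX EY JY) := by
  let := W.instN
  have := W.instC
  obtain ⟨F, hF⟩ := W.exists_framedSubgroup
  exact F.nonempty_moduleSideZ2 (F.inducedAut_eq_grade hY hc) (by rw [hF]; exact W.closed_X₀)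

namespace HilbertBimod

variable {Z : Type} [NormedAddCommGroup Z] (E : HilbertBimod C D Z)

lemma norm_rsmul_le (z : Z) (d : D) : ‖E.rsmul z d‖ ≤ ‖z‖ * ‖d‖ := by
  rw [← E.vnorm_toPre, ← E.vnorm_toPre z]
  exact PreHilbertBimod.vnorm_rsmul_le z d

lemma norm_lsmul_le (c : C) (z : Z) : ‖E.lsmul c z‖ ≤ ‖c‖ * ‖z‖ := by
  have := E.dual.norm_rsmul_le z (star c)
  rw [norm_star, mul_comm] at this
  simpa [dual, PreHilbertBimod.dual, toPre] using this

lemma realCompat : E.toPre.RealCompat := fun r z => by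
  have hl : Continuous fun r : ℝ => E.toPre.lsmul (algebraMap ℝ C r) z :=
    (AddMonoidHomClass.continuous_of_bound (E.toPre.lsmulRight z) ‖z‖ fun c =>
      (E.norm_lsmul_le c z).trans_eq (mul_comm _ _)).comp (algebraMapCLM ℝ C).continuous
  have hr : Continuous fun r : ℝ => E.toPre.rsmul z (algebraMap ℝ D r) :=
    (AddMonoidHomClass.continuous_of_bound (E.toPre.rsmulLeft z) ‖z‖
      (E.norm_rsmul_le z)).comp (algebraMapCLM ℝ D).continuous
  refine congrFun ((Rat.isDenseEmbedding_coe_real.dense).equalizer hl hr (funext fun q => ?_)) r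
  have hq : ((q.den : ℝ)) ≠ 0 := by exact_mod_cast q.den_nz
  have hn : ((q.den : ℝ)) * q = q.num := by exact_mod_cast Rat.den_mul_eq_num q
  have hnatl : ∀ w : Z, E.toPre.lsmul (algebraMap ℝ C (q.den : ℝ)) w = q.den • w := fun w => by
    have := map_nsmul (E.toPre.lsmulRight w) q.den 1
    simpa [PreHilbertBimod.lsmulRight, E.toPre.one_lsmul] using this
  have hnatr : ∀ w : Z, E.toPre.rsmul w (algebraMap ℝ D (q.den : ℝ)) = q.den • w := fun w => by
    have := map_nsmul (E.toPre.rsmulLeft w) q.den 1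
    simpa [PreHilbertBimod.rsmulLeft, E.toPre.rsmul_one] using this
  have hintl : E.toPre.lsmul (algebraMap ℝ C (q.num : ℝ)) z = q.num • z := by
    have := map_zsmul (E.toPre.lsmulRight z) q.num 1
    simpa [PreHilbertBimod.lsmulRight, E.toPre.one_lsmul] using this
  have hintr : E.toPre.rsmul z (algebraMap ℝ D (q.num : ℝ)) = q.num • z := by
    have := map_zsmul (E.toPre.rsmulLeft z) q.num 1
    simpa [PreHilbertBimod.rsmulLeft, E.toPre.rsmul_one] using this
  have key : E.toPre.lsmul (algebraMap ℝ C (q.den : ℝ)) (E.toPre.lsmul (algebraMap ℝ C q) z) =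
      E.toPre.lsmul (algebraMap ℝ C (q.den : ℝ)) (E.toPre.rsmul z (algebraMap ℝ D q)) := by
    rw [← E.toPre.mul_lsmul, ← map_mul, hn, hintl, hnatl, ← hnatr, ← E.toPre.rsmul_mul, ← map_mul,
      mul_comm, hn, hintr]
  have hinv : ∀ w : Z, E.toPre.lsmul (algebraMap ℝ C (q.den : ℝ)⁻¹)
      (E.toPre.lsmul (algebraMap ℝ C (q.den : ℝ)) w) = w := fun w => by
    rw [← E.toPre.mul_lsmul, ← map_mul, inv_mul_cancel₀ hq, map_one, E.toPre.one_lsmul]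
  exact (hinv _).symm.trans ((congrArg _ key).trans (hinv _))

lemma norm_rinner_le (x y : Z) : ‖E.rinner x y‖ ≤ ‖x‖ * ‖y‖ := by
  have := PreHilbertBimod.norm_rinner_le E.realCompat x y
  rwa [E.vnorm_toPre, E.vnorm_toPre] at this

lemma norm_linner_le (x y : Z) : ‖E.linner x y‖ ≤ ‖x‖ * ‖y‖ := E.dual.norm_rinner_le x y

end HilbertBimod

lemma TensorData.norm_tmul_le {R Z V T : Type} [CStarAlgebra R] [NormedAddCommGroup Z]
    [NormedAddCommGroup V] [NormedAddCommGroup T] {E : HilbertBimod C D Z} {F : HilbertBimod D R V}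
    {G : HilbertBimod C R T} (t : TensorData E F G) (z : Z) (v : V) :
    ‖t.tmul z v‖ ≤ ‖z‖ * ‖v‖ := by
  refine abs_le_of_sq_le_sq' ?_ (by positivity) |>.2
  rw [← G.norm_rinner_self, t.rinner_tmul]
  calc _ ≤ ‖v‖ * (‖E.rinner z z‖ * ‖v‖) := (F.norm_rinner_le _ _).trans
        (mul_le_mul_of_nonneg_left (F.norm_lsmul_le _ _) (norm_nonneg _))
    _ = _ := by rw [E.norm_rinner_self]; ring

/-- An embedding of bimodules compatible with framed inner products exhibits a strong Morita
equivalence of unital inclusions. -/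
theorem PreHilbertBimod.stronglyMoritaEquivalentIncl {Z M : Type} [AddCommGroup Z] [AddCommGroup M]
    {E : PreHilbertBimod C D Z} {H : PreHilbertBimod A B M} (hE : E.RealCompat)
    {ιA : A →⋆ₐ[ℂ] C} {ιB : B →⋆ₐ[ℂ] D} (hA : IsClosed (Set.range ιA))
    (hB : IsClosed (Set.range ιB)) (ι : M →+ Z)
    (hl : ∀ a p, E.lsmul (ιA a) (ι p) = ι (H.lsmul a p))
    (hr : ∀ p b, E.rsmul (ι p) (ιB b) = ι (H.rsmul p b))
    (hli : ∀ p q, E.linner (ι p) (ι q) = ιA (H.linner p q))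
    (hri : ∀ p q, E.rinner (ι p) (ι q) = ιB (H.rinner p q))
    {k : ℕ} {u v : Fin k → M} (hL : H.IsLFrame u v)
    {l : ℕ} {s t : Fin l → M} (hR : H.IsRFrame s t) :
    StronglyMoritaEquivalentIncl C D (Submodule.span ℂ (Set.range ιA))
      (Submodule.span ℂ (Set.range ιB)) := by
  have hLE : E.IsLFrame (ι ∘ u) (ι ∘ v) := by
    simp only [IsLFrame, Function.comp_apply, hli, ← map_sum]
    rw [hL, map_one]
  have hRE : E.IsRFrame (ι ∘ s) (ι ∘ t) := by
    simp only [IsRFrame, Function.comp_apply, hri, ← map_sum]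
    rw [hR, map_one]
  have hsA : Submodule.span ℂ (Set.range ιA) = LinearMap.range ιA.toAlgHom.toLinearMap :=
    Submodule.span_eq (LinearMap.range ιA.toAlgHom.toLinearMap)
  have hsB : Submodule.span ℂ (Set.range ιB) = LinearMap.range ιB.toAlgHom.toLinearMap :=
    Submodule.span_eq (LinearMap.range ιB.toAlgHom.toLinearMap)
  have hmA : ∀ {c}, c ∈ Submodule.span ℂ (Set.range ιA) ↔ ∃ a, ιA a = c := by
    rw [hsA]; exact Iff.rfl
  have hmB : ∀ {d}, d ∈ Submodule.span ℂ (Set.range ιB) ↔ ∃ b, ιB b = d := by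
    rw [hsB]; exact Iff.rfl
  have hAspan : Submodule.span ℂ {c : C | ∃ x ∈ ι.range, ∃ y ∈ ι.range, c = E.linner x y} =
      Submodule.span ℂ (Set.range ιA) := by
    refine le_antisymm (Submodule.span_le.mpr ?_) (Submodule.span_le.mpr ?_)
    · rintro _ ⟨_, ⟨p, rfl⟩, _, ⟨q, rfl⟩, rfl⟩
      exact hmA.mpr ⟨_, (hli p q).symm⟩
    · rintro _ ⟨a, rfl⟩
      rw [← mul_one a, ← hL, Finset.mul_sum, map_sum]
      refine Submodule.sum_mem _ fun i _ => Submodule.subset_span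
        ⟨ι (H.lsmul a (u i)), ⟨_, rfl⟩, ι (v i), ⟨_, rfl⟩, ?_⟩
      rw [hli, H.linner_lsmul_left]
  have hBspan : Submodule.span ℂ {d : D | ∃ x ∈ ι.range, ∃ y ∈ ι.range, d = E.rinner x y} =
      Submodule.span ℂ (Set.range ιB) := by
    refine le_antisymm (Submodule.span_le.mpr ?_) (Submodule.span_le.mpr ?_)
    · rintro _ ⟨_, ⟨p, rfl⟩, _, ⟨q, rfl⟩, rfl⟩
      exact hmB.mpr ⟨_, (hri p q).symm⟩
    · rintro _ ⟨b, rfl⟩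
      rw [← one_mul b, ← hR, Finset.sum_mul, map_sum]
      refine Submodule.sum_mem _ fun i _ => Submodule.subset_span
        ⟨ι (s i), ⟨_, rfl⟩, ι (H.rsmul (t i) b), ⟨_, rfl⟩, ?_⟩
      rw [hri, H.rinner_rsmul_right]
  let := (vectorNorm hE hLE).toNormedAddCommGroup
  have := completeSpace hE hLE
  have hclosed : IsClosed (ι.range : Set Z) := by
    have : (ι.range : Set Z) = ⋂ i, {z | E.rinner (ι (v i)) z ∈ Set.range ιB} := by
      ext z
      simp only [Set.mem_iInter, Set.mem_ofPred_eq]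
      constructor
      · rintro ⟨p, rfl⟩ i
        exact ⟨_, (hri _ _).symm⟩
      · intro h
        choose b hb using h
        refine ⟨∑ i, H.rsmul (u i) (b i), ?_⟩
        rw [map_sum, hLE.expand z]
        exact Finset.sum_congr rfl fun i _ => by rw [← hr, hb]; rfl
    rw [this]
    have hcont : ∀ x, Continuous (E.rinner x) := fun x =>
      AddMonoidHomClass.continuous_of_bound (E.rinnerRight x) (E.vnorm x) (norm_rinner_le hE x)
    exact isClosed_iInter fun i => hB.preimage (hcont _)
  exact ⟨{
    Y := Z
    E := toHilbertBimod hE hLE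
    lFull := HilbertBimod.lFull_of_isLFrame hLE
    rFull := HilbertBimod.rFull_of_isRFrame hRE
    X₀ := ι.range
    closed_X₀ := hclosed
    lsmul_mem := by
      rintro a _ ha ⟨p, rfl⟩
      obtain ⟨a, rfl⟩ := hmA.mp ha
      exact ⟨_, (hl a p).symm⟩
    rsmul_mem := by
      rintro _ b ⟨p, rfl⟩ hb
      obtain ⟨b, rfl⟩ := hmB.mp hb
      exact ⟨_, (hr p b).symm⟩
    linner_mem := by
      rintro _ _ ⟨p, rfl⟩ ⟨q, rfl⟩
      exact hmA.mpr ⟨_, (hli p q).symm⟩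
    rinner_mem := by
      rintro _ _ ⟨p, rfl⟩ ⟨q, rfl⟩
      exact hmB.mpr ⟨_, (hri p q).symm⟩
    linner_full := by
      refine (congrArg _ hAspan).trans (IsClosed.submodule_topologicalClosure_eq ?_)
      rw [hsA]; exact hA
    rinner_full := by
      refine (congrArg _ hBspan).trans (IsClosed.submodule_topologicalClosure_eq ?_)
      rw [hsB]; exact hB
    linner_span := by
      refine top_unique (le_trans (fun c _ => ?_) (Submodule.le_topologicalClosure _))
      rw [← mul_one c, ← hLE, Finset.mul_sum]
      refine Submodule.sum_mem _ fun i _ => Submodule.subset_span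
        ⟨E.lsmul c (ι (u i)), ι (v i), ⟨_, rfl⟩, (E.linner_lsmul_left _ _ _).symm⟩
    rinner_span := by
      refine top_unique (le_trans (fun d _ => ?_) (Submodule.le_topologicalClosure _))
      rw [← mul_one d, ← hRE, Finset.mul_sum]
      refine Submodule.sum_mem _ fun i _ => Submodule.subset_span
        ⟨E.rsmul (ι (s i)) (star d), ι (t i), ⟨_, rfl⟩, ?_⟩
      refine ((E.rinner_rsmul_left _ _ _).trans ?_).symm
      rw [star_star]; rfl }⟩

/-- A `D`-valued pairing making an `A`-`B`-bimodule `M` induce a `C`-`D`-bimodule, where `C` and `D`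
contain `A` and `B`. -/
structure Amplification {M : Type} [AddCommGroup M] (H : PreHilbertBimod A B M)
    (ιA : A →⋆ₐ[ℂ] C) (ιB : B →⋆ₐ[ℂ] D) where
  σ : M → C → M → D
  σ_add_left : ∀ m m' c n, σ (m + m') c n = σ m c n + σ m' c n
  σ_add_mid : ∀ m c c' n, σ m (c + c') n = σ m c n + σ m c' n
  σ_add_right : ∀ m c n n', σ m c (n + n') = σ m c n + σ m c n'
  σ_mul : ∀ m c n m' c' n', σ m c n * σ m' c' n' = σ m (c * ιA (H.linner n m') * c') n'
  σ_star : ∀ m c n, star (σ m c n) = σ n (star c) m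
  σ_rsmul : ∀ m c n b, σ m c (H.rsmul n b) = σ m c n * ιB b
  σ_ιA : ∀ m a n, σ m (ιA a) n = ιB (H.rinner m (H.lsmul a n))
  faithful : ∀ c, (∀ m n, σ m c n = 0) → c = 0
  exists_σ : ∀ d p q, ∃ c, ∀ m n, σ m c n = ιB (H.rinner m p) * d * ιB (H.rinner q n)

namespace Amplification

variable {M : Type} [AddCommGroup M] {H : PreHilbertBimod A B M} {ιA : A →⋆ₐ[ℂ] C}
  {ιB : B →⋆ₐ[ℂ] D} (S : Amplification H ιA ιB)

lemma σ_one (m n : M) : S.σ m 1 n = ιB (H.rinner m n) := by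
  rw [← map_one ιA, S.σ_ιA, H.one_lsmul]

lemma σ_rsmul_left (m : M) (b : B) (c : C) (n : M) :
    S.σ (H.rsmul m b) c n = star (ιB b) * S.σ m c n := by
  rw [← star_star (S.σ (H.rsmul m b) c n), S.σ_star, S.σ_rsmul, star_mul, S.σ_star, star_star]

lemma eq_of_σ_eq {c c' : C} (h : ∀ m n, S.σ m c n = S.σ m c' n) : c = c' := by
  refine sub_eq_zero.mp (S.faithful _ fun m n => ?_)
  have := S.σ_add_mid m (c - c') c' n
  rw [sub_add_cancel, h] at this
  exact right_eq_add.mp this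

lemma σ_sum_mid {ι : Type*} (s : Finset ι) (m : M) (f : ι → C) (n : M) :
    S.σ m (∑ i ∈ s, f i) n = ∑ i ∈ s, S.σ m (f i) n :=
  map_sum (AddMonoidHom.mk' (fun c => S.σ m c n) fun c c' => S.σ_add_mid m c c' n) f s

/-- The conjugate-linear maps from `M` to `D`. -/
def space (_ : Amplification H ιA ιB) : AddSubgroup (M → D) where
  carrier := {f | (∀ m m', f (m + m') = f m + f m') ∧ ∀ m b, f (H.rsmul m b) = star (ιB b) * f m}
  zero_mem' := by simp
  add_mem' := by
    rintro f g ⟨hf, hf'⟩ ⟨hg, hg'⟩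
    refine ⟨fun m m' => ?_, fun m b => ?_⟩
    · simp only [Pi.add_apply, hf, hg]; abel
    · simp only [Pi.add_apply, hf', hg', mul_add]
  neg_mem' := by
    rintro f ⟨hf, hf'⟩
    refine ⟨fun m m' => ?_, fun m b => ?_⟩
    · simp only [Pi.neg_apply, hf]; abel
    · simp only [Pi.neg_apply, hf', mul_neg]

variable {S}

lemma space_ext {f g : S.space} (h : ∀ m, f.1 m = g.1 m) : f = g := Subtype.ext (funext h)

variable {k : ℕ} {u v : Fin k → M} (hL : H.IsLFrame u v)

include hL in
lemma expand (f : S.space) (m : M) : f.1 m = ∑ i, ιB (H.rinner m (v i)) * f.1 (u i) := by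
  conv_lhs => rw [hL.expand m]
  refine (map_sum (AddMonoidHom.mk' f.1 f.2.1) (fun i => H.rsmul (u i) (H.rinner (v i) m)) _).trans ?_
  refine Finset.sum_congr rfl fun i _ => (f.2.2 _ _).trans ?_
  rw [← map_star, H.rinner_star]

include hL in
lemma sum_σ_mul_σ (m : M) (c c' : C) (n : M) :
    ∑ i, S.σ m c (v i) * S.σ (u i) c' n = S.σ m (c * c') n := by
  simp only [S.σ_mul]
  rw [← S.σ_sum_mid, ← Finset.sum_mul, ← Finset.mul_sum, ← map_sum, hL.symm, map_one, mul_one]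

variable (S u v) in
/-- The action of `C` on the conjugate-linear maps. -/
def act (c : C) (f : S.space) : S.space :=
  ⟨fun m => ∑ i, S.σ m c (v i) * f.1 (u i),
    fun m m' => by simp only [S.σ_add_left, add_mul, Finset.sum_add_distrib],
    fun m b => by simp only [S.σ_rsmul_left, mul_assoc, Finset.mul_sum]⟩

lemma act_apply (c : C) (f : S.space) (m : M) :
    (S.act u v c f).1 m = ∑ i, S.σ m c (v i) * f.1 (u i) := rfl

include hL in
lemma exists_linner (f g : S.space) : ∃ c, ∀ m n, S.σ m c n = f.1 m * star (g.1 n) := by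
  choose c hc using fun i j => S.exists_σ (f.1 (u i) * star (g.1 (u j))) (v i) (v j)
  refine ⟨∑ i, ∑ j, c i j, fun m n => ?_⟩
  rw [expand hL f m, expand hL g n, star_sum, Finset.sum_mul_sum, S.σ_sum_mid]
  refine Finset.sum_congr rfl fun i _ => ?_
  rw [S.σ_sum_mid]
  refine Finset.sum_congr rfl fun j _ => ?_
  rw [hc, star_mul, ← map_star, H.rinner_star]
  simp only [mul_assoc]

/-- The `C`-valued inner product on the conjugate-linear maps. -/
def linner (f g : S.space) : C := (exists_linner hL f g).choose

lemma σ_linner (f g : S.space) (m n : M) : S.σ m (linner hL f g) n = f.1 m * star (g.1 n) :=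
  (exists_linner hL f g).choose_spec m n

include hL in
lemma sum_star_mul (f g : S.space) :
    ∑ i, star (f.1 (v i)) * g.1 (u i) = ∑ i, star (f.1 (u i)) * g.1 (v i) := by
  have h1 : ∀ i, star (f.1 (v i)) * g.1 (u i) =
      ∑ j, star (f.1 (u j)) * (ιB (H.rinner (v j) (v i)) * g.1 (u i)) := fun i => by
    rw [expand hL f (v i), star_sum, Finset.sum_mul]
    exact Finset.sum_congr rfl fun j _ => by
      rw [star_mul, ← map_star, H.rinner_star, mul_assoc]
  simp only [h1]
  rw [Finset.sum_comm]
  exact Finset.sum_congr rfl fun j _ => by rw [← Finset.mul_sum, ← expand hL g (v j)]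

variable (S) in
/-- The `C`-`D`-bimodule induced by an amplification. -/
def bimod : PreHilbertBimod C D S.space where
  lsmul := S.act u v
  rsmul f d := ⟨fun m => f.1 m * d, fun m m' => by simp only [f.2.1, add_mul],
    fun m b => by simp only [f.2.2, mul_assoc]⟩
  linner := linner hL
  rinner f g := ∑ i, star (f.1 (v i)) * g.1 (u i)
  lsmul_add c f g := space_ext fun m => by
    change _ = (S.act u v c f).1 m + (S.act u v c g).1 m
    simp only [act_apply, ← Finset.sum_add_distrib, ← mul_add]; rfl
  add_lsmul c c' f := space_ext fun m => by
    change _ = (S.act u v c f).1 m + (S.act u v c' f).1 m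
    simp only [act_apply, ← Finset.sum_add_distrib, ← add_mul, S.σ_add_mid]
  mul_lsmul c c' f := space_ext fun m => by
    simp only [act_apply, Finset.mul_sum, ← mul_assoc, ← sum_σ_mul_σ hL, Finset.sum_mul]
    exact Finset.sum_comm
  one_lsmul f := space_ext fun m => by
    simp only [act_apply, S.σ_one, ← expand hL f m]
  rsmul_add f g d := space_ext fun m => add_mul _ _ _
  add_rsmul f d d' := space_ext fun m => mul_add _ _ _
  rsmul_mul f d d' := space_ext fun m => (mul_assoc _ _ _).symm
  rsmul_one f := space_ext fun m => mul_one _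
  lsmul_rsmul c f d := space_ext fun m => by
    change (S.act u v c f).1 m * d = _
    simp only [act_apply, Finset.sum_mul, mul_assoc]
  linner_add_left f g h := S.eq_of_σ_eq fun m n => by
    rw [S.σ_add_mid, σ_linner, σ_linner, σ_linner, ← add_mul]; rfl
  linner_add_right f g h := S.eq_of_σ_eq fun m n => by
    rw [S.σ_add_mid, σ_linner, σ_linner, σ_linner, ← mul_add, ← star_add]; rfl
  linner_lsmul_left c f g := S.eq_of_σ_eq fun m n => by
    simp only [← sum_σ_mul_σ hL, σ_linner, act_apply, Finset.sum_mul, mul_assoc]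
  linner_star f g := S.eq_of_σ_eq fun m n => by
    rw [← S.σ_star, σ_linner, σ_linner, star_mul, star_star]
  rinner_add_left f g h := by
    rw [← Finset.sum_add_distrib]
    refine Finset.sum_congr rfl fun i _ => ?_
    rw [← add_mul, ← star_add]; rfl
  rinner_add_right f g h := by
    rw [← Finset.sum_add_distrib]
    refine Finset.sum_congr rfl fun i _ => ?_
    rw [← mul_add]; rfl
  rinner_rsmul_right f g d := by simp only [Finset.sum_mul, mul_assoc]
  rinner_star f g := by
    rw [sum_star_mul hL f g, star_sum]
    exact Finset.sum_congr rfl fun i _ => by rw [star_mul, star_star]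
  inner_assoc f g h := space_ext fun m => by
    simp only [act_apply, σ_linner, Finset.mul_sum, mul_assoc]

variable (S) in
lemma bimod_realCompat (hH : H.RealCompat) : (S.bimod hL).RealCompat := fun r f => space_ext fun m => by
  change ∑ i, S.σ m (algebraMap ℝ C r) (v i) * f.1 (u i) = f.1 m * algebraMap ℝ D r
  have hC : algebraMap ℝ C r = ιA (algebraMap ℝ A r) := (ιA.toAlgHom.restrictScalars ℝ).commutes r |>.symm
  have hD : algebraMap ℝ D r = ιB (algebraMap ℝ B r) := (ιB.toAlgHom.restrictScalars ℝ).commutes r |>.symm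
  rw [expand hL f m, Finset.sum_mul]
  refine Finset.sum_congr rfl fun i _ => ?_
  rw [hC, S.σ_ιA, hH, H.rinner_rsmul_right, map_mul, ← hD, mul_assoc, mul_assoc, Algebra.commutes]

variable (S) in
/-- The embedding of `M` into the induced bimodule. -/
def embed : M →+ S.space where
  toFun p := ⟨fun m => ιB (H.rinner m p), fun m m' => by simp only [H.rinner_add_left, map_add],
    fun m b => by simp only [H.rinner_rsmul_left, map_mul, map_star]⟩
  map_zero' := space_ext fun m => by
    change ιB (H.rinner m 0) = 0
    rw [H.rinner_zero_right, map_zero]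
  map_add' p q := space_ext fun m => by
    change ιB (H.rinner m (p + q)) = ιB (H.rinner m p) + ιB (H.rinner m q)
    rw [H.rinner_add_right, map_add]

lemma embed_apply (p m : M) : (S.embed p).1 m = ιB (H.rinner m p) := rfl

variable (S) in
include S hL in
theorem stronglyMoritaEquivalentIncl (hA : IsClosed (Set.range ιA)) (hB : IsClosed (Set.range ιB))
    (hH : H.RealCompat) {l : ℕ} {s t : Fin l → M} (hR : H.IsRFrame s t) :
    StronglyMoritaEquivalentIncl C D (Submodule.span ℂ (Set.range ιA))
      (Submodule.span ℂ (Set.range ιB)) := by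
  refine PreHilbertBimod.stronglyMoritaEquivalentIncl (S.bimod_realCompat hL hH) hA hB S.embed
    (H := H) (fun a p => space_ext fun m => ?_) (fun p b => space_ext fun m => ?_)
    (fun p q => S.eq_of_σ_eq fun m n => ?_) (fun p q => ?_) hL hR
  · change ∑ i, S.σ m (ιA a) (v i) * ιB (H.rinner (u i) p) = ιB (H.rinner m (H.lsmul a p))
    rw [← S.σ_ιA]
    simp only [← S.σ_one, sum_σ_mul_σ hL, mul_one]
  · change ιB (H.rinner m p) * ιB b = ιB (H.rinner m (H.rsmul p b))
    rw [H.rinner_rsmul_right, map_mul]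
  · change S.σ m (linner hL _ _) n = _
    rw [σ_linner, S.σ_ιA, H.inner_assoc, H.rinner_rsmul_right, map_mul, embed_apply, embed_apply,
      ← map_star, H.rinner_star]
  · change ∑ i, star (ιB (H.rinner (v i) p)) * ιB (H.rinner (u i) q) = _
    conv_rhs => rw [hL.symm.expand q, H.rinner_sum_right, map_sum]
    exact Finset.sum_congr rfl fun i _ => by
      rw [H.rinner_rsmul_right, map_mul, ← map_star, H.rinner_star]

end Amplification

lemma TensorData.mem_of_isClosed {R Z V T : Type} [CStarAlgebra R] [NormedAddCommGroup Z]
    [NormedAddCommGroup V] [NormedAddCommGroup T] {E : HilbertBimod C D Z} {F : HilbertBimod D R V}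
    {G : HilbertBimod C R T} (t : TensorData E F G) {P : AddSubgroup T} (hP : IsClosed (P : Set T))
    (h : ∀ z v, t.tmul z v ∈ P) (ξ : T) : ξ ∈ P := by
  have : AddSubgroup.closure {t' : T | ∃ x y, t' = t.tmul x y} ≤ P :=
    (AddSubgroup.closure_le _).mpr (by rintro _ ⟨z, v, rfl⟩; exact h z v)
  exact hP.closure_subset_iff.mpr this (t.tmul_dense ξ)

lemma IsBimodIso.norm_map {Z V : Type} [NormedAddCommGroup Z] [NormedAddCommGroup V]
    {E : HilbertBimod C D Z} {F : HilbertBimod C D V} {φ : Z → V} (h : IsBimodIso E F φ) (z : Z) :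
    ‖φ z‖ = ‖z‖ := by
  rw [← sq_eq_sq₀ (norm_nonneg _) (norm_nonneg _), ← F.norm_linner_self, h.map_linner,
    E.norm_linner_self]

namespace ModuleSideZ2

attribute [local instance] ModuleSideZ2.instM ModuleSideZ2.instMC ModuleSideZ2.instM'
  ModuleSideZ2.instT₁ ModuleSideZ2.instT

variable {EX : HilbertBimod A A X} {JX : Involution EX} {EY : HilbertBimod B B Y}
  {JY : Involution EY} (S : ModuleSideZ2 EX JX EY JY)

/-- The image in `Y` of an elementary tensor. -/
def tensor (m : S.M) (x : X) (n : S.M) : Y := S.Φ (S.TD.tmul (S.TD₁.tmul (S.DD.conj m) x) n)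

lemma tensor_add_left (m m' : S.M) (x : X) (n : S.M) :
    S.tensor (m + m') x n = S.tensor m x n + S.tensor m' x n := by
  rw [tensor, S.DD.conj_add, S.TD₁.tmul_add_left, S.TD.tmul_add_left, S.hΦ.map_add]; rfl

lemma tensor_add_mid (m : S.M) (x x' : X) (n : S.M) :
    S.tensor m (x + x') n = S.tensor m x n + S.tensor m x' n := by
  rw [tensor, S.TD₁.tmul_add_right, S.TD.tmul_add_left, S.hΦ.map_add]; rfl

lemma tensor_add_right (m : S.M) (x : X) (n n' : S.M) :
    S.tensor m x (n + n') = S.tensor m x n + S.tensor m x n' := by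
  rw [tensor, S.TD.tmul_add_right, S.hΦ.map_add]; rfl

lemma tensor_rsmul_mid (m : S.M) (x : X) (a : A) (n : S.M) :
    S.tensor m (EX.rsmul x a) n = S.tensor m x (S.EM.lsmul a n) := by
  rw [tensor, ← S.TD₁.rsmul_tmul, S.TD.tmul_balanced]; rfl

lemma tensor_lsmul_mid (m : S.M) (a : A) (x : X) (n : S.M) :
    S.tensor m (EX.lsmul a x) n = S.tensor (S.EM.lsmul (star a) m) x n := by
  rw [tensor, ← S.TD₁.tmul_balanced, S.DD.rsmul_conj]; rfl

lemma tensor_rsmul_right (m : S.M) (x : X) (n : S.M) (b : B) :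
    S.tensor m x (S.EM.rsmul n b) = EY.rsmul (S.tensor m x n) b := by
  rw [tensor, ← S.TD.rsmul_tmul, S.hΦ.map_rsmul]; rfl

lemma tensor_rsmul_left (m : S.M) (b : B) (x : X) (n : S.M) :
    S.tensor (S.EM.rsmul m b) x n = EY.lsmul (star b) (S.tensor m x n) := by
  have := S.DD.lsmul_conj (star b) m
  rw [star_star] at this
  rw [tensor, ← this, ← S.TD₁.lsmul_tmul, ← S.TD.lsmul_tmul, S.hΦ.map_lsmul]; rfl

lemma invol_tensor (m : S.M) (x : X) (n : S.M) :
    JY.invol (S.tensor m x n) = S.tensor n (JX.invol x) m := by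
  rw [tensor, ← S.hΦJ, S.hJT]; rfl

lemma linner_tensor (m : S.M) (x : X) (n m' : S.M) (x' : X) (n' : S.M) :
    EY.linner (S.tensor m x n) (S.tensor m' x' n') =
      S.EM.rinner (S.EM.lsmul (star (EX.linner (EX.rsmul x (S.EM.linner n n')) x')) m) m' := by
  rw [tensor, tensor, S.hΦ.map_linner, S.TD.linner_tmul, S.TD₁.rsmul_tmul, S.TD₁.linner_tmul,
    S.DD.rsmul_conj, S.DD.linner_conj]

lemma norm_tensor_le (m : S.M) (x : X) (n : S.M) : ‖S.tensor m x n‖ ≤ ‖m‖ * ‖x‖ * ‖n‖ := by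
  rw [tensor, S.hΦ.norm_map, ← S.DD.norm_conj m]
  exact (S.TD.norm_tmul_le _ _).trans
    (mul_le_mul_of_nonneg_right (S.TD₁.norm_tmul_le _ _) (norm_nonneg _))

lemma mem_of_isClosed {P : AddSubgroup Y} (hP : IsClosed (P : Set Y))
    (h : ∀ m x n, S.tensor m x n ∈ P) (y : Y) : y ∈ P := by
  let Φ : S.T →+ Y := AddMonoidHom.mk' S.Φ S.hΦ.map_add
  have hΦ : Continuous Φ := (AddMonoidHomClass.isometry_of_norm Φ S.hΦ.norm_map).continuous
  obtain ⟨ξ, rfl⟩ := S.hΦ.bijective.2 y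
  refine S.TD.mem_of_isClosed (P := P.comap Φ) (hP.preimage hΦ) (fun t n => ?_) ξ
  let f : S.T₁ →+ S.T := AddMonoidHom.mk' (fun t => S.TD.tmul t n) fun t t' =>
    S.TD.tmul_add_left t t' n
  have hf : Continuous f := AddMonoidHomClass.continuous_of_bound f ‖n‖ fun t =>
    (S.TD.norm_tmul_le t n).trans_eq (mul_comm _ _)
  refine S.TD₁.mem_of_isClosed (P := P.comap (Φ.comp f)) (hP.preimage (hΦ.comp hf))
    (fun m' x => ?_) t
  obtain ⟨m, rfl⟩ := S.DD.conj_bijective.2 m'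
  exact h m x n

end ModuleSideZ2

lemma PreHilbertBimod.IsLFrame.eq_of_rinner_lsmul {Z : Type} [AddCommGroup Z]
    {H : PreHilbertBimod C D Z} {k : ℕ} {u v : Fin k → Z} (h : H.IsLFrame u v) {c c' : C}
    (hc : ∀ x y, H.rinner x (H.lsmul c y) = H.rinner x (H.lsmul c' y)) : c = c' :=
  h.faithful fun i => by rw [h.expand (H.lsmul c _), h.expand (H.lsmul c' _)]; simp only [hc]

namespace ModuleSideZ2

attribute [local instance] ModuleSideZ2.instM ModuleSideZ2.instMC ModuleSideZ2.instM'
  ModuleSideZ2.instT₁ ModuleSideZ2.instT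

variable {EX : HilbertBimod A A X} {JX : Involution EX} {EY : HilbertBimod B B Y}
  {JY : Involution EY} (S : ModuleSideZ2 EX JX EY JY) (BX : InvolBundleAlg EX JX C)
  (BY : InvolBundleAlg EY JY D)

/-- The `D`-valued pairing on `M` determined by an element of `C`. -/
def pairing (m : S.M) (c : C) (n : S.M) : D :=
  BY.ιA (S.EM.rinner m (S.EM.lsmul (BX.prA c) n)) + BY.ιX (S.tensor m (BX.prX c) n)

lemma pairing_ιA (m : S.M) (a : A) (n : S.M) :
    S.pairing BX BY m (BX.ιA a) n = BY.ιA (S.EM.rinner m (S.EM.lsmul a n)) := by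
  have : S.tensor m 0 n = 0 := by simpa using S.tensor_add_mid m 0 0 n
  rw [pairing, BX.prA_ιA, BX.prX_ιA, this, map_zero, add_zero]

lemma pairing_ιX (m : S.M) (x : X) (n : S.M) :
    S.pairing BX BY m (BX.ιX x) n = BY.ιX (S.tensor m x n) := by
  have : S.EM.rinner m (S.EM.lsmul 0 n) = 0 := by
    exact (congrArg _ (S.EM.toPre.zero_lsmul n)).trans (S.EM.toPre.rinner_zero_right m)
  rw [pairing, BX.prA_ιX, BX.prX_ιX, this, map_zero, zero_add]

lemma pairing_add_left (m m' : S.M) (c : C) (n : S.M) :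
    S.pairing BX BY (m + m') c n = S.pairing BX BY m c n + S.pairing BX BY m' c n := by
  simp only [pairing, S.EM.rinner_add_left, S.tensor_add_left, map_add]; abel

lemma pairing_add_mid (m : S.M) (c c' : C) (n : S.M) :
    S.pairing BX BY m (c + c') n = S.pairing BX BY m c n + S.pairing BX BY m c' n := by
  simp only [pairing, map_add, S.EM.add_lsmul, S.EM.rinner_add_right, S.tensor_add_mid]; abel

lemma pairing_add_right (m : S.M) (c : C) (n n' : S.M) :
    S.pairing BX BY m c (n + n') = S.pairing BX BY m c n + S.pairing BX BY m c n' := by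
  simp only [pairing, S.EM.lsmul_add, S.EM.rinner_add_right, S.tensor_add_right, map_add]; abel

lemma pairing_sum_mid {ι : Type*} (s : Finset ι) (m : S.M) (f : ι → C) (n : S.M) :
    S.pairing BX BY m (∑ i ∈ s, f i) n = ∑ i ∈ s, S.pairing BX BY m (f i) n :=
  map_sum (AddMonoidHom.mk' (fun c => S.pairing BX BY m c n) fun c c' =>
    S.pairing_add_mid BX BY m c c' n) f s

lemma pairing_rsmul (m : S.M) (c : C) (n : S.M) (b : B) :
    S.pairing BX BY m c (S.EM.rsmul n b) = S.pairing BX BY m c n * BY.ιA b := by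
  simp only [pairing, ← S.EM.lsmul_rsmul, S.EM.rinner_rsmul_right, S.tensor_rsmul_right, map_mul,
    add_mul, BY.mul_XA]

lemma pairing_ιA_mul_ιA (m : S.M) (a : A) (n m' : S.M) (a' : A) (n' : S.M) :
    S.pairing BX BY m (BX.ιA a) n * S.pairing BX BY m' (BX.ιA a') n' =
      S.pairing BX BY m (BX.ιA a * BX.ιA (S.EM.linner n m') * BX.ιA a') n' := by
  simp only [← map_mul, pairing_ιA]
  rw [S.EM.mul_lsmul, S.EM.mul_lsmul, S.EM.inner_assoc, ← S.EM.lsmul_rsmul,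
    S.EM.rinner_rsmul_right]

lemma pairing_ιA_mul_ιX (m : S.M) (a : A) (n m' : S.M) (x' : X) (n' : S.M) :
    S.pairing BX BY m (BX.ιA a) n * S.pairing BX BY m' (BX.ιX x') n' =
      S.pairing BX BY m (BX.ιA a * BX.ιA (S.EM.linner n m') * BX.ιX x') n' := by
  rw [← map_mul, BX.mul_AX, pairing_ιA, pairing_ιX, pairing_ιX, BY.mul_AX, S.tensor_lsmul_mid,
    ← S.EM.linner_lsmul_left, S.EM.linner_star, S.EM.inner_assoc, S.tensor_rsmul_left,
    S.EM.rinner_star]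

lemma pairing_ιX_mul_ιA (m : S.M) (x : X) (n m' : S.M) (a' : A) (n' : S.M) :
    S.pairing BX BY m (BX.ιX x) n * S.pairing BX BY m' (BX.ιA a') n' =
      S.pairing BX BY m (BX.ιX x * BX.ιA (S.EM.linner n m') * BX.ιA a') n' := by
  rw [BX.mul_XA, BX.mul_XA, pairing_ιA, pairing_ιX, pairing_ιX, BY.mul_XA, S.tensor_rsmul_mid,
    S.tensor_rsmul_mid, S.EM.inner_assoc, S.tensor_rsmul_right]

variable {l : ℕ} {s t : Fin l → S.M} (hR : S.EM.toPre.IsRFrame s t)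

include hR

lemma rinner_lsmul_left (a : A) (m n : S.M) :
    S.EM.rinner (S.EM.lsmul a m) n = S.EM.rinner m (S.EM.lsmul (star a) n) :=
  hR.rinner_lsmul_left a m n

lemma pairing_star (m : S.M) (c : C) (n : S.M) :
    star (S.pairing BX BY m c n) = S.pairing BX BY n (star c) m := by
  induction c using BX.induction with | hp a x
  rw [pairing_add_mid, star_add, star_add, pairing_add_mid, pairing_ιA, pairing_ιX, ← map_star BX.ιA,
    ← map_star BY.ιA, BX.star_X, BY.star_X, pairing_ιA, pairing_ιX, S.invol_tensor, S.EM.rinner_star,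
    S.rinner_lsmul_left hR]

lemma pairing_ιX_mul_ιX (m : S.M) (x : X) (n m' : S.M) (x' : X) (n' : S.M) :
    S.pairing BX BY m (BX.ιX x) n * S.pairing BX BY m' (BX.ιX x') n' =
      S.pairing BX BY m (BX.ιX x * BX.ιA (S.EM.linner n m') * BX.ιX x') n' := by
  rw [BX.mul_XA, BX.mul_XX, pairing_ιA, pairing_ιX, pairing_ιX, BY.mul_XX, S.invol_tensor,
    S.linner_tensor, S.rinner_lsmul_left hR, star_star]

lemma pairing_mul (m : S.M) (c : C) (n m' : S.M) (c' : C) (n' : S.M) :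
    S.pairing BX BY m c n * S.pairing BX BY m' c' n' =
      S.pairing BX BY m (c * BX.ιA (S.EM.linner n m') * c') n' := by
  induction c using BX.induction with | hp a x
  induction c' using BX.induction with | hp a' x'
  simp only [add_mul, mul_add, pairing_add_mid, S.pairing_ιA_mul_ιA BX BY,
    S.pairing_ιA_mul_ιX BX BY, S.pairing_ιX_mul_ιA BX BY, S.pairing_ιX_mul_ιX BX BY hR]

variable {k : ℕ} {u v : Fin k → S.M} (hL : S.EM.toPre.IsLFrame u v)

include hL

lemma sum_pairing_mul (m : S.M) (c c' : C) (n : S.M) :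
    ∑ i, S.pairing BX BY m c (u i) * S.pairing BX BY (v i) c' n = S.pairing BX BY m (c * c') n := by
  simp only [S.pairing_mul BX BY hR]
  rw [← pairing_sum_mid, ← Finset.sum_mul, ← Finset.mul_sum, ← map_sum]
  have : ∑ i, S.EM.linner (u i) (v i) = 1 := hL
  rw [this, map_one, mul_one]

include BX in
lemma norm_le_of_tensor_eq {x : X} {y : Y} {p q : S.M}
    (h : ∀ m n, BY.ιX (S.tensor m x n) =
      BY.ιA (S.EM.rinner m p) * BY.ιX y * BY.ιA (S.EM.rinner q n)) :
    ‖x‖ ≤ ‖p‖ * ‖q‖ * ‖y‖ := by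
  set b := EY.linner (EY.rsmul y (S.EM.rinner q q)) y with hb
  have hb' : BY.ιA b = BY.ιX y * BY.ιA (S.EM.rinner q q) * star (BY.ιX y) := by
    rw [hb, BY.ιA_linner, BY.mul_XA]
  have key : EX.linner x x = S.EM.linner (S.EM.rsmul p b) p := by
    refine hL.eq_of_rinner_lsmul fun m n => BY.ιA_injective ?_
    have h1 := S.sum_pairing_mul BX BY hR hL m (BX.ιX x) (star (BX.ιX x)) n
    rw [← BX.ιA_linner, pairing_ιA] at h1
    refine h1.symm.trans ?_
    have h2 : ∀ i, S.pairing BX BY m (BX.ιX x) (u i) * S.pairing BX BY (v i) (star (BX.ιX x)) n =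
        BY.ιA (S.EM.rinner m p) * BY.ιX y *
          BY.ιA (S.EM.rinner q (S.EM.rsmul (u i) (S.EM.rinner (v i) q))) * star (BY.ιX y) *
          BY.ιA (S.EM.rinner p n) := fun i => by
      rw [← S.pairing_star BX BY hR, pairing_ιX, pairing_ιX, h, h, S.EM.rinner_rsmul_right, map_mul]
      simp only [star_mul, ← map_star, S.EM.rinner_star, mul_assoc]
    rw [Finset.sum_congr rfl fun i _ => h2 i]
    rw [← Finset.sum_mul, ← Finset.sum_mul, ← Finset.mul_sum, ← map_sum]
    have h3 : ∑ i, S.EM.rinner q (S.EM.rsmul (u i) (S.EM.rinner (v i) q)) = S.EM.rinner q q := by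
      refine (S.EM.toPre.rinner_sum_right _ _ _).symm.trans ?_
      exact congrArg _ (hL.expand q).symm
    change _ = BY.ιA (S.EM.rinner m (S.EM.lsmul (S.EM.linner (S.EM.rsmul p b) p) n))
    rw [h3, S.EM.inner_assoc, S.EM.rinner_rsmul_right, S.EM.rinner_rsmul_right, map_mul, map_mul,
      hb']
    simp only [mul_assoc]
  refine abs_le_of_sq_le_sq' ?_ (by positivity) |>.2
  rw [← EX.norm_linner_self, key]
  have hbn : ‖b‖ ≤ ‖y‖ * ‖q‖ ^ 2 * ‖y‖ := (EY.norm_linner_le _ _).trans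
    (mul_le_mul_of_nonneg_right ((EY.norm_rsmul_le _ _).trans_eq
      (by rw [S.EM.norm_rinner_self])) (norm_nonneg _))
  calc _ ≤ ‖p‖ * ‖b‖ * ‖p‖ := (S.EM.norm_linner_le _ _).trans
        (mul_le_mul_of_nonneg_right (S.EM.norm_rsmul_le _ _) (norm_nonneg _))
    _ ≤ ‖p‖ * (‖y‖ * ‖q‖ ^ 2 * ‖y‖) * ‖p‖ := by gcongr
    _ = _ := by ring

include BX in
lemma exists_tensor_eq (y : Y) (p q : S.M) : ∃ x, ∀ m n, BY.ιX (S.tensor m x n) =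
    BY.ιA (S.EM.rinner m p) * BY.ιX y * BY.ιA (S.EM.rinner q n) := by
  have := BX.completeSpace
  have := BY.completeSpace
  let P : AddSubgroup (X × Y) :=
    { carrier := {z | ∀ m n, BY.ιX (S.tensor m z.1 n) =
        BY.ιA (S.EM.rinner m p) * BY.ιX z.2 * BY.ιA (S.EM.rinner q n)}
      zero_mem' := fun m n => by
        have : S.tensor m 0 n = 0 := by simpa using S.tensor_add_mid m 0 0 n
        simp [this]
      add_mem' := fun {z w} hz hw m n => by
        rw [Prod.fst_add, Prod.snd_add, S.tensor_add_mid, map_add, hz, hw, map_add, mul_add, add_mul]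
      neg_mem' := fun {z} hz m n => by
        have : S.tensor m (-z.1) n = -S.tensor m z.1 n :=
          map_neg (AddMonoidHom.mk' (fun x => S.tensor m x n) fun x x' =>
            S.tensor_add_mid m x x' n) z.1
        rw [Prod.fst_neg, Prod.snd_neg, this, map_neg, hz, map_neg, mul_neg, neg_mul] }
  have hcont : ∀ m n, Continuous fun x => S.tensor m x n := fun m n =>
    AddMonoidHomClass.continuous_of_bound (AddMonoidHom.mk' (fun x => S.tensor m x n) fun x x' =>
      S.tensor_add_mid m x x' n) (‖m‖ * ‖n‖) fun x => (S.norm_tensor_le m x n).trans_eq (by ring)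
  have hP : IsClosed (P : Set (X × Y)) := by
    have : (P : Set (X × Y)) = ⋂ m, ⋂ n, {z | BY.ιX (S.tensor m z.1 n) =
        BY.ιA (S.EM.rinner m p) * BY.ιX z.2 * BY.ιA (S.EM.rinner q n)} := by
      ext z; simp only [Set.mem_iInter]; exact Iff.rfl
    rw [this]
    refine isClosed_iInter fun m => isClosed_iInter fun n => isClosed_eq
      (BY.isometry_ιX.continuous.comp ((hcont m n).comp continuous_fst)) ?_
    exact (continuous_const.mul (BY.isometry_ιX.continuous.comp continuous_snd)).mul continuous_const
  have : CompleteSpace P := hP.completeSpace_coe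
  let π : P →+ Y := (AddMonoidHom.snd X Y).comp P.subtype
  have hπ : Continuous π := continuous_snd.comp continuous_subtype_val
  have hanti : AntilipschitzWith (‖p‖₊ * ‖q‖₊ + 1) π :=
    AddMonoidHomClass.antilipschitz_of_bound π fun z => by
      have h1 := S.norm_le_of_tensor_eq BX BY hR hL z.2
      have h2 : ‖z‖ = max ‖z.1.1‖ ‖z.1.2‖ := rfl
      have h3 : 0 ≤ ‖p‖ * ‖q‖ * ‖z.1.2‖ := by positivity
      have h4 : 0 ≤ ‖z.1.2‖ := norm_nonneg _
      rw [h2]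
      push_cast
      change _ ≤ (‖p‖ * ‖q‖ + 1) * ‖z.1.2‖
      exact max_le (by linarith) (by linarith)
  have hcl : IsClosed (π.range : Set Y) := hanti.isClosed_range
    (uniformContinuous_addMonoidHom_of_continuous hπ)
  obtain ⟨z, hz⟩ := S.mem_of_isClosed hcl (fun m' x n' => by
    refine ⟨⟨(EX.rsmul (EX.lsmul (S.EM.linner p m') x) (S.EM.linner n' q),
      S.tensor m' x n'), fun m n => ?_⟩, rfl⟩
    rw [BY.mul_AX, BY.mul_XA, S.tensor_rsmul_mid, S.tensor_lsmul_mid, S.EM.linner_star,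
      S.EM.inner_assoc, S.EM.inner_assoc, S.tensor_rsmul_right, S.tensor_rsmul_left,
      S.EM.rinner_star]) y
  refine ⟨z.1.1, fun m n => ?_⟩
  rw [← hz]
  exact z.2 m n

/-- The amplification determined by an implementing bimodule. -/
def amplification : Amplification S.EM.toPre BX.ιA BY.ιA where
  σ := S.pairing BX BY
  σ_add_left := S.pairing_add_left BX BY
  σ_add_mid := S.pairing_add_mid BX BY
  σ_add_right := S.pairing_add_right BX BY
  σ_mul := S.pairing_mul BX BY hR
  σ_star := S.pairing_star BX BY hR
  σ_rsmul := S.pairing_rsmul BX BY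
  σ_ιA := S.pairing_ιA BX BY
  faithful c hc := by
    have hA : BX.prA c = 0 := hL.eq_of_rinner_lsmul fun m n => by
      have := congrArg BY.prA (hc m n)
      rw [pairing, map_add, BY.prA_ιA, BY.prA_ιX, add_zero, map_zero] at this
      exact this.trans (by rw [PreHilbertBimod.zero_lsmul, PreHilbertBimod.rinner_zero_right])
    have hX : BX.prX c = 0 := by
      have h := S.norm_le_of_tensor_eq BX BY hR hL (x := BX.prX c) (y := 0) (p := 0) (q := 0)
        fun m n => by
          have := hc m n
          have h0 : S.EM.rinner m 0 = 0 := S.EM.toPre.rinner_zero_right m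
          have hz : S.EM.lsmul 0 n = 0 := S.EM.toPre.zero_lsmul n
          rw [pairing, hA, hz] at this
          rw [h0, map_zero, zero_add] at this
          rw [this, map_zero, mul_zero, zero_mul]
      simpa using h
    rw [← BX.prA_add_prX c, hA, hX, map_zero, map_zero, add_zero]
  exists_σ d p q := by
    induction d using BY.induction with | hp b y
    obtain ⟨x, hx⟩ := S.exists_tensor_eq BX BY hR hL y p q
    refine ⟨BX.ιA (S.EM.linner (S.EM.rsmul p b) q) + BX.ιX x, fun m n => ?_⟩
    rw [pairing_add_mid, pairing_ιA, pairing_ιX, hx, S.EM.inner_assoc, S.EM.rinner_rsmul_right,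
      S.EM.rinner_rsmul_right, map_mul, map_mul, mul_add, add_mul]
    rfl

omit hR hL

include S BX BY in
theorem stronglyMoritaEquivalentIncl : StronglyMoritaEquivalentIncl C D
    (Submodule.span ℂ (Set.range BX.ιA)) (Submodule.span ℂ (Set.range BY.ιA)) := by
  obtain ⟨k, u, v, hL⟩ := S.lFull.exists_isLFrame
  obtain ⟨l, s, t, hR⟩ := S.rFull.exists_isRFrame
  exact (S.amplification BX BY hR hL).stronglyMoritaEquivalentIncl hL
    BX.isometry_ιA.isClosedEmbedding.isClosed_range
    BY.isometry_ιA.isClosedEmbedding.isClosed_range S.EM.realCompat hR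

end ModuleSideZ2

/-- Theorem 5.14 of the paper.
Let `X`, `Y` be involutive Hilbert bimodules over the unital C*-algebras
`A`, `B`, and `A ⊆ C_X`, `B ⊆ C_Y` the induced unital inclusions of unital
C*-algebras.  Then:
(1) if there is an `A`-`B`-equivalence bimodule `M` with
`M̃ ⊗_A X ⊗_A M ≅ Y` as involutive Hilbert `B`-`B`-bimodules, then
`A ⊆ C_X` and `B ⊆ C_Y` are strongly Morita equivalent;
(2) if `X` and `Y` are full with both inner products, `A' ∩ C_X = ℂ1`, and
`A ⊆ C_X` and `B ⊆ C_Y` are strongly Morita equivalent, then there is an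
`A`-`B`-equivalence bimodule `M` with `M̃ ⊗_A X ⊗_A M ≅ Y` as involutive
Hilbert `B`-`B`-bimodules. -/
theorem involutive_bimodule_strong_morita
    (EX : HilbertBimod A A X) (JX : Involution EX)
    (EY : HilbertBimod B B Y) (JY : Involution EY)
    (BX : InvolBundleAlg EX JX C) (BY : InvolBundleAlg EY JY D) :
    -- (1)
    (Nonempty (ModuleSideZ2 EX JX EY JY) →
      StronglyMoritaEquivalentIncl C D
        (Submodule.span ℂ (Set.range ⇑BX.ιA))
        (Submodule.span ℂ (Set.range ⇑BY.ιA))) ∧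
    -- (2)
    (EX.LFull → EX.RFull → EY.LFull → EY.RFull →
      (∀ c : C, (∀ a : A, BX.ιA a * c = c * BX.ιA a) →
        ∃ z : ℂ, c = algebraMap ℂ C z) →
      StronglyMoritaEquivalentIncl C D
        (Submodule.span ℂ (Set.range ⇑BX.ιA))
        (Submodule.span ℂ (Set.range ⇑BY.ιA)) →
      Nonempty (ModuleSideZ2 EX JX EY JY)) := by
  exact ⟨fun ⟨S⟩ => S.stronglyMoritaEquivalentIncl BX BY,
    fun _ _ hY _ hc ⟨W⟩ => W.nonempty_moduleSideZ2 BX BY hY hc⟩
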